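/- arXiv:2412.12889 — 3 statements merged into one kernel-verified Lean document; each statement's English description precedes it below -/
import Mathlib

section
/- For every integer n ≥ 3 and every integer i with 1 ≤ i ≤ n − 2, the i-th homotopy group π_i(Ñ₀, x₀) at the basepoint x₀ = 0 ∈ Ñ₀ is trivial (the underlying pointed set of homotopy classes is a subsingleton). -/
open scoped Topology

/-- The sup-distance from `y` to the centre of the unit cube with integer vertices containing it. -/
noncomputable def cubeNorm {ι : Type*} [Fintype ι] (y : ι → ℝ) : ℝ :=
  ‖fun j => |Int.fract (y j) - 1 / 2|‖

section cubeNorm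

variable {ι : Type*} [Fintype ι]

theorem continuous_cubeNorm : Continuous (cubeNorm : (ι → ℝ) → ℝ) := by
  refine continuous_norm.comp (continuous_pi fun j => ?_)
  refine ContinuousOn.comp_fract (f := fun _ t => |t - 1 / 2|) ?_ (continuous_apply j) ?_
  · exact Continuous.continuousOn (by unfold Function.uncurry; fun_prop)
  · intro s
    norm_num [abs_of_pos]

theorem abs_fract_sub_half_le_cubeNorm (y : ι → ℝ) (j : ι) :
    |Int.fract (y j) - 1 / 2| ≤ cubeNorm y := by
  simpa [cubeNorm] using norm_le_pi_norm (fun j => |Int.fract (y j) - 1 / 2|) j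

theorem abs_fract_sub_half_le_half (t : ℝ) : |Int.fract t - 1 / 2| ≤ 1 / 2 := by
  rw [abs_le]
  constructor <;> linarith [Int.fract_nonneg t, Int.fract_lt_one t]

theorem cubeNorm_le_half (y : ι → ℝ) : cubeNorm y ≤ 1 / 2 := by
  refine (pi_norm_le_iff_of_nonneg (by norm_num)).2 fun j => ?_
  simpa using abs_fract_sub_half_le_half (y j)

theorem cubeNorm_nonneg (y : ι → ℝ) : 0 ≤ cubeNorm y := norm_nonneg _

theorem cubeNorm_eq_half {y : ι → ℝ} (hy : ∃ j, ∃ k : ℤ, y j = k) : cubeNorm y = 1 / 2 := by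
  obtain ⟨j, k, hj⟩ := hy
  refine le_antisymm (cubeNorm_le_half y) ?_
  have h := abs_fract_sub_half_le_cubeNorm y j
  rw [hj, Int.fract_intCast] at h
  norm_num [abs_of_pos] at h ⊢
  exact h

theorem exists_abs_fract_sub_half_eq_cubeNorm [Nonempty ι] (y : ι → ℝ) :
    ∃ j, |Int.fract (y j) - 1 / 2| = cubeNorm y := by
  obtain ⟨j, hj⟩ := Finite.exists_max fun j => |Int.fract (y j) - 1 / 2|
  refine ⟨j, le_antisymm (abs_fract_sub_half_le_cubeNorm y j) ?_⟩
  refine (pi_norm_le_iff_of_nonneg (abs_nonneg _)).2 fun i => ?_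
  simpa using hj i

theorem eq_floor_add_half_of_cubeNorm_eq_zero {y : ι → ℝ} (hy : cubeNorm y = 0) (j : ι) :
    y j = ⌊y j⌋ + 1 / 2 := by
  have h := abs_fract_sub_half_le_cubeNorm y j
  rw [hy] at h
  have h' := abs_eq_zero.1 (le_antisymm h (abs_nonneg _))
  rw [Int.fract] at h'
  linarith

/-- A point close to the centre of a cube has small `cubeNorm`. -/
theorem cubeNorm_le_of_cubeNorm_eq_zero {y z : ι → ℝ} {r : ℝ} (hr0 : 0 ≤ r) (hr : r < 1 / 2)
    (hz : cubeNorm z = 0) (hyz : ∀ j, |y j - z j| ≤ r) : cubeNorm y ≤ r := by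
  refine (pi_norm_le_iff_of_nonneg hr0).2 fun j => ?_
  have h1 := eq_floor_add_half_of_cubeNorm_eq_zero hz j
  have h2 := hyz j
  have h3 := abs_le.1 h2
  have hfl : ⌊y j⌋ = ⌊z j⌋ := by
    rw [Int.floor_eq_iff]
    constructor <;> linarith
  have : Int.fract (y j) - 1 / 2 = y j - z j := by
    rw [Int.fract, hfl]
    linarith
  rwa [this, norm_abs_eq_norm, Real.norm_eq_abs]

end cubeNorm

/-- Radial projection onto the boundary of the unit cube from its centre, in one coordinate:
stretch `t` by the factor `max 1 s` inside its unit interval, then clamp to that interval. -/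
noncomputable def stretchFract (s t : ℝ) : ℝ :=
  ⌊t⌋ + max 0 (min 1 (1 / 2 + max 1 s * (Int.fract t - 1 / 2)))

theorem Continuous.stretchFract {E : Type*} [TopologicalSpace E] {s t : E → ℝ}
    (hs : Continuous s) (ht : Continuous t) : Continuous fun x => stretchFract (s x) (t x) := by
  have h : Continuous fun x => t x +
      (max 0 (min 1 (1 / 2 + max 1 (s x) * (Int.fract (t x) - 1 / 2))) - Int.fract (t x)) := by
    refine ht.add ?_
    refine ContinuousOn.comp_fract
      (f := fun x u => max 0 (min 1 (1 / 2 + max 1 (s x) * (u - 1 / 2))) - u) ?_ ht ?_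
    · exact Continuous.continuousOn (by unfold Function.uncurry; fun_prop)
    · intro x
      have h1 : 1 ≤ max 1 (s x) := le_max_left _ _
      rw [max_eq_left, min_eq_left, max_eq_right] <;> try linarith
      exact (min_le_right _ _).trans (by linarith)
  refine h.congr fun x => ?_
  rw [_root_.stretchFract, Int.fract]
  ring

/-- The cubical `(n-1)`-skeleton is a retract of the complement of the cube centres. -/
theorem exists_continuous_retraction_to_skeleton {E ι : Type*} [TopologicalSpace E] [Fintype ι]
    [Nonempty ι] {g : E → ι → ℝ} (hg : Continuous g) (hg0 : ∀ x, cubeNorm (g x) ≠ 0) :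
    ∃ K : E → ι → ℝ, Continuous K ∧ (∀ x, ∃ j, ∃ k : ℤ, K x j = k) ∧
      ∀ x, (∃ j, ∃ k : ℤ, g x j = k) → K x = g x := by
  have hw : Continuous fun x => (2 * cubeNorm (g x))⁻¹ :=
    (continuous_const.mul (continuous_cubeNorm.comp hg)).inv₀
      fun x => mul_ne_zero two_ne_zero (hg0 x)
  refine ⟨fun x j => stretchFract (2 * cubeNorm (g x))⁻¹ (g x j),
    continuous_pi fun j => hw.stretchFract ((continuous_apply j).comp hg), fun x => ?_,
    fun x hx => ?_⟩
  · obtain ⟨j, hj⟩ := exists_abs_fract_sub_half_eq_cubeNorm (g x)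
    have hpos : 0 < cubeNorm (g x) := (cubeNorm_nonneg _).lt_of_ne' (hg0 x)
    have hle := cubeNorm_le_half (g x)
    have h1 : max 1 (2 * cubeNorm (g x))⁻¹ = (2 * cubeNorm (g x))⁻¹ :=
      max_eq_right ((one_le_inv₀ (by linarith)).2 (by linarith))
    refine ⟨j, ?_⟩
    rcases abs_choice (Int.fract (g x j) - 1 / 2) with h | h
    · refine ⟨⌊g x j⌋ + 1, ?_⟩
      have h2 : (2 * cubeNorm (g x))⁻¹ * (Int.fract (g x j) - 1 / 2) = 1 / 2 := by
        rw [← h, hj]; field_simp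
      simp only [stretchFract, h1, h2]
      norm_num
    · refine ⟨⌊g x j⌋, ?_⟩
      have h2 : (2 * cubeNorm (g x))⁻¹ * (Int.fract (g x j) - 1 / 2) = -(1 / 2) := by
        rw [← neg_neg (Int.fract (g x j) - 1 / 2), ← h, hj]; field_simp
      simp only [stretchFract, h1, h2]
      norm_num
  · funext j
    have h0 := Int.fract_nonneg (g x j)
    have h1 := Int.fract_lt_one (g x j)
    have h2 : 1 / 2 + max 1 (2 * cubeNorm (g x))⁻¹ * (Int.fract (g x j) - 1 / 2)
        = Int.fract (g x j) := by
      rw [cubeNorm_eq_half hx]; norm_num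
    simp only [stretchFract, h2]
    rw [min_eq_right h1.le, max_eq_right h0, Int.floor_add_fract]

/-- A small generic translation of a `C¹` map from a lower-dimensional space avoids the centres of
all cubes. -/
theorem exists_translate_cubeNorm_ne_zero {E ι : Type*} [NormedAddCommGroup E] [NormedSpace ℝ E]
    [FiniteDimensional ℝ E] [Fintype ι] (hE : Module.finrank ℝ E < Fintype.card ι)
    {P : E → ι → ℝ} (hP : ContDiff ℝ 1 P) {ε : ℝ} (hε : 0 < ε) :
    ∃ c : ι → ℝ, ‖c‖ < ε ∧ ∀ x, cubeNorm (P x + c) ≠ 0 := by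
  set S : Set (ι → ℝ) := ⋃ k : ι → ℤ, Set.range fun x => (fun j => (k j : ℝ) + 1 / 2) - P x
  have hS : dimH S < Module.finrank ℝ (ι → ℝ) := by
    rw [dimH_iUnion, Module.finrank_fintype_fun_eq_card]
    refine (iSup_le fun k => ?_).trans_lt (Nat.cast_lt.2 hE)
    exact (contDiff_const.sub hP).dimH_range_le
  obtain ⟨c, hcS, hc⟩ := (dense_compl_of_dimH_lt_finrank hS).exists_dist_lt 0 hε
  refine ⟨c, by simpa using hc, fun x hx => hcS ?_⟩
  refine Set.mem_iUnion.2 ⟨fun j => ⌊(P x + c) j⌋, x, ?_⟩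
  funext j
  have := eq_floor_add_half_of_cubeNorm_eq_zero hx j
  simp only [Pi.sub_apply, Pi.add_apply] at this ⊢
  linarith

/-- A map from a space of dimension less than `n` to `ℝⁿ` can be pushed into the cubical
`(n-1)`-skeleton without moving the points already mapped to it. -/
theorem exists_continuous_to_skeleton {E ι : Type*} [NormedAddCommGroup E] [NormedSpace ℝ E]
    [FiniteDimensional ℝ E] [Fintype ι] (hE : Module.finrank ℝ E < Fintype.card ι)
    {G : E → ι → ℝ} (hG : Continuous G) :
    ∃ K : E → ι → ℝ, Continuous K ∧ (∀ x, ∃ j, ∃ k : ℤ, K x j = k) ∧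
      ∀ x, (∃ j, ∃ k : ℤ, G x j = k) → K x = G x := by
  have : Nonempty ι := Fintype.card_pos_iff.1 (by omega)
  obtain ⟨P, hP, hPG, -⟩ := hG.exists_contDiff_approx 1
    (ε := fun _ => 1 / 8) continuous_const (fun _ => by norm_num)
  obtain ⟨c, hc, hcP⟩ := exists_translate_cubeNorm_ne_zero hE hP (ε := 1 / 8) (by norm_num)
  set φ : E → ℝ := fun x => max 0 (min 1 (2 - 4 * cubeNorm (G x)))
  have hw : Continuous fun x => cubeNorm (G x) := continuous_cubeNorm.comp hG
  have hφ : Continuous φ := by fun_prop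
  have hφ0 : ∀ x, 0 ≤ φ x := fun x => le_max_left _ _
  have hφ1 : ∀ x, φ x ≤ 1 := fun x => max_le zero_le_one (min_le_left _ _)
  set g : E → ι → ℝ := fun x => G x + φ x • (P x + c - G x)
  have hPc : Continuous P := hP.continuous
  have hg : Continuous g := by fun_prop
  have hclose : ∀ x j, |G x j - g x j| ≤ 1 / 4 := by
    intro x j
    have h1 : ‖P x + c - G x‖ ≤ 1 / 4 := by
      have h2 : ‖P x - G x‖ < 1 / 8 := by simpa [dist_eq_norm] using hPG x
      calc ‖P x + c - G x‖ = ‖(P x - G x) + c‖ := by congr 1; abel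
        _ ≤ ‖P x - G x‖ + ‖c‖ := norm_add_le _ _
        _ ≤ 1 / 4 := by linarith
    have h3 := (norm_le_pi_norm (P x + c - G x) j).trans h1
    have h4 : G x j - g x j = -(φ x * (P x + c - G x) j) := by simp [g]
    rw [h4, abs_neg, abs_mul, abs_of_nonneg (hφ0 x)]
    rw [Real.norm_eq_abs] at h3
    exact (mul_le_of_le_one_left (abs_nonneg _) (hφ1 x)).trans h3
  have hg0 : ∀ x, cubeNorm (g x) ≠ 0 := by
    intro x hx
    have h1 := cubeNorm_le_of_cubeNorm_eq_zero (by norm_num) (by norm_num) hx (hclose x)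
    have h2 : φ x = 1 := by
      simp only [φ]
      rw [min_eq_left (by linarith), max_eq_right zero_le_one]
    refine hcP x ?_
    rwa [show g x = P x + c by simp [g, h2]] at hx
  have hgG : ∀ x, (∃ j, ∃ k : ℤ, G x j = k) → g x = G x := by
    intro x hx
    have h2 : φ x = 0 := by
      simp only [φ, cubeNorm_eq_half hx]
      norm_num
    simp [g, h2]
  obtain ⟨K, hK, hK1, hK2⟩ := exists_continuous_retraction_to_skeleton hg hg0
  refine ⟨K, hK, hK1, fun x hx => ?_⟩
  rw [hK2 x (by rwa [hgG x hx]), hgG x hx]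

/-- For `n ≥ 3` and `1 ≤ i ≤ n − 2`, the homotopy group `π_i(Ñ₀, 0)` of the
`(n−1)`-skeleton `Ñ₀` of the unit cubical decomposition of `ℝⁿ` is trivial. -/
theorem stmt_12 (n : ℕ) (hn : 3 ≤ n) (i : ℕ) (hi1 : 1 ≤ i) (hi2 : i ≤ n - 2) :
    Subsingleton (HomotopyGroup.Pi i
      {x : EuclideanSpace ℝ (Fin n) // ∃ j, ∃ k : ℤ, x j = (k : ℝ)}
      ⟨0, ⟨⟨0, by omega⟩, 0, by simp⟩⟩) := by
  refine subsingleton_of_forall_eq (Quotient.mk _ GenLoop.const) fun q => ?_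
  induction q using Quotient.inductionOn with | _ f => ?_
  refine Quotient.sound ?_
  set clamp : ℝ → unitInterval := Set.projIcc 0 1 zero_le_one with hclamp
  have hcl : Continuous clamp := continuous_projIcc
  set G : (Fin i → ℝ) × ℝ → Fin n → ℝ := fun p j =>
    (1 - (clamp p.2 : ℝ)) * (f fun l => clamp (p.1 l)).1 j
  have hG : Continuous G := by
    have hf : Continuous fun p : (Fin i → ℝ) × ℝ => (f fun l => clamp (p.1 l)).1 :=
      continuous_subtype_val.comp (f.1.continuous.comp (by fun_prop))
    refine continuous_pi fun j => ?_
    have : Continuous fun p : (Fin i → ℝ) × ℝ => (f fun l => clamp (p.1 l)).1 j := by fun_prop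
    fun_prop
  obtain ⟨K, hK, hK1, hK2⟩ := exists_continuous_to_skeleton (by simp; omega) hG
  have hGv : ∀ (s : unitInterval) (t : Fin i → unitInterval),
      G (fun l => t l, s) = fun j => (1 - (s : ℝ)) * (f t).1 j := by
    intro s t
    simp [G, hclamp]
  have h0 : ∃ j : Fin n, ∃ k : ℤ, (0 : Fin n → ℝ) j = k := ⟨⟨0, by omega⟩, 0, by simp⟩
  refine ⟨⟨⟨⟨fun p => ⟨WithLp.toLp 2 (K (fun l => p.2 l, p.1)), hK1 _⟩, ?_⟩, ?_, ?_⟩, ?_⟩⟩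
  · refine Continuous.subtype_mk ((PiLp.continuous_toLp 2 _).comp (hK.comp ?_)) _
    fun_prop
  · intro t
    have h : G (fun l => t l, ((0 : unitInterval) : ℝ)) = (f t).1.ofLp := by
      rw [hGv]; simp
    refine Subtype.ext ?_
    change WithLp.toLp 2 (K _) = _
    rw [hK2 _ (by rw [h]; exact (f t).2), h]
    rfl
  · intro t
    have h : G (fun l => t l, ((1 : unitInterval) : ℝ)) = 0 := by
      rw [hGv]; ext; simp
    refine Subtype.ext ?_
    change WithLp.toLp 2 (K _) = _
    rw [hK2 _ (by rw [h]; exact h0), h]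
    rfl
  · intro s t ht
    have hft := GenLoop.boundary f t ht
    have h : G (fun l => t l, (s : ℝ)) = 0 := by
      rw [hGv, hft]; ext; simp
    refine Subtype.ext ?_
    change WithLp.toLp 2 (K _) = (f t).1
    rw [hK2 _ (by rw [h]; exact h0), h, hft]
    rfl
end

section
/- For every integer n ≥ 3 and every integer i with 2 ≤ i ≤ n − 2, the i-th homotopy group π_i(N₀, y₀) at the basepoint y₀ = 0 ∈ N₀ is trivial (the underlying pointed set of homotopy classes is a subsingleton). -/
open scoped Topology

open scoped unitInterval

noncomputable section

/-- For `0 < c < 1`, the `1`-periodic function on `ℝ` which vanishes exactly on `c + ℤ`, equals `1`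
on `ℤ`, and is affine in between. -/
def periodicGauge (c u : ℝ) : ℝ :=
  max ((Int.fract u - c) / (1 - c)) ((c - Int.fract u) / c)

section Gauge

variable {c : ℝ}

lemma continuous_periodicGauge (h0 : 0 < c) (h1 : c < 1) : Continuous (periodicGauge c) := by
  have h : ContinuousOn (fun v : ℝ => max ((v - c) / (1 - c)) ((c - v) / c)) (Set.Icc 0 1) := by
    fun_prop
  refine ContinuousOn.comp_fract'' h ?_
  have : 0 < 1 - c := by linarith
  have e1 : (0 - c) / (1 - c) ≤ 1 := by rw [div_le_one this]; linarith
  have e2 : (c - 1) / c ≤ 1 := by rw [div_le_one h0]; linarith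
  simp only [sub_zero, div_self h0.ne', div_self this.ne']
  rw [max_eq_right e1, max_eq_left e2]

lemma periodicGauge_nonneg (h0 : 0 < c) (h1 : c < 1) (u : ℝ) : 0 ≤ periodicGauge c u := by
  rcases le_total c (Int.fract u) with h | h
  · exact le_max_of_le_left (div_nonneg (by linarith) (by linarith))
  · exact le_max_of_le_right (div_nonneg (by linarith) h0.le)

lemma periodicGauge_le_one (h0 : 0 < c) (h1 : c < 1) (u : ℝ) : periodicGauge c u ≤ 1 := by
  have := Int.fract_nonneg u
  have := Int.fract_lt_one u
  refine max_le ?_ ?_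
  · rw [div_le_one (by linarith)]; linarith
  · rw [div_le_one h0]; linarith

lemma periodicGauge_of_fract_eq_zero (h0 : 0 < c) (h1 : c < 1) {u : ℝ} (hu : Int.fract u = 0) :
    periodicGauge c u = 1 := by
  refine le_antisymm (periodicGauge_le_one h0 h1 u) (le_max_of_le_right ?_)
  rw [hu, sub_zero, div_self h0.ne']

lemma fract_eq_of_periodicGauge_eq_zero (h0 : 0 < c) (h1 : c < 1) {u : ℝ}
    (hu : periodicGauge c u = 0) : Int.fract u = c := by
  have e1 : (Int.fract u - c) / (1 - c) ≤ 0 := hu ▸ le_max_left _ _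
  have e2 : (c - Int.fract u) / c ≤ 0 := hu ▸ le_max_right _ _
  rw [div_le_iff₀ (by linarith)] at e1
  rw [div_le_iff₀ h0] at e2
  linarith

lemma add_div_periodicGauge (h0 : 0 < c) (h1 : c < 1) {u : ℝ} (hu : periodicGauge c u ≠ 0) :
    c + (Int.fract u - c) / periodicGauge c u = 0 ∨
      c + (Int.fract u - c) / periodicGauge c u = 1 := by
  have h2 : 1 - c ≠ 0 := by linarith
  have h3 := h0.ne'
  rcases max_choice ((Int.fract u - c) / (1 - c)) ((c - Int.fract u) / c) with h | h
  · right
    change periodicGauge c u = _ at h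
    rw [h] at hu ⊢
    have : Int.fract u - c ≠ 0 := fun h => hu (by simp [h])
    field_simp
    ring
  · left
    change periodicGauge c u = _ at h
    rw [h] at hu ⊢
    have : c - Int.fract u ≠ 0 := fun h => hu (by simp [h])
    field_simp
    ring

end Gauge

section Retraction

variable {ι : Type*} [Fintype ι] {c x : ι → ℝ}

/-- The radial coordinate, relative to the centre `c + z`, of a point in the cube `z + [0, 1]^ι`
of the integer lattice. -/
def latticeRadius (c x : ι → ℝ) : ℝ :=
  ‖fun j => periodicGauge (c j) (x j)‖

/-- The radial projection of each cube of the integer lattice, minus its centre in `c + ℤ^ι`, to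
the boundary of that cube, with values in the torus. -/
def radialProjection (c x : ι → ℝ) (j : ι) : AddCircle (1 : ℝ) :=
  ((c j + (Int.fract (x j) - c j) / latticeRadius c x : ℝ) : AddCircle (1 : ℝ))

lemma continuous_latticeRadius (hc : ∀ j, 0 < c j ∧ c j < 1) : Continuous (latticeRadius c) :=
  (continuous_pi fun j =>
    (continuous_periodicGauge (hc j).1 (hc j).2).comp (continuous_apply j)).norm

lemma latticeRadius_ne_zero (hc : ∀ j, 0 < c j ∧ c j < 1)
    (hx : ∀ z : ι → ℤ, x ≠ fun j => c j + z j) : latticeRadius c x ≠ 0 := by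
  intro h
  refine hx (fun j => ⌊x j⌋) (funext fun j => ?_)
  have h' := congrFun (norm_eq_zero.1 h) j
  rw [← fract_eq_of_periodicGauge_eq_zero (hc j).1 (hc j).2 h', Int.fract_add_floor]

lemma latticeRadius_eq_one (hc : ∀ j, 0 < c j ∧ c j < 1) {j : ι} (hx : Int.fract (x j) = 0) :
    latticeRadius c x = 1 := by
  refine le_antisymm ((pi_norm_le_iff_of_nonneg zero_le_one).2 fun k => ?_) ?_
  · rw [Real.norm_of_nonneg (periodicGauge_nonneg (hc k).1 (hc k).2 _)]
    exact periodicGauge_le_one (hc k).1 (hc k).2 _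
  · have := norm_le_pi_norm (fun j => periodicGauge (c j) (x j)) j
    rwa [periodicGauge_of_fract_eq_zero (hc j).1 (hc j).2 hx, norm_one] at this

lemma coe_fract (u : ℝ) : ((Int.fract u : ℝ) : AddCircle (1 : ℝ)) = u := by
  rw [← sub_eq_zero, ← AddCircle.coe_sub, AddCircle.coe_eq_zero_iff]
  exact ⟨-⌊u⌋, by simp⟩

lemma fract_eq_zero_of_coe_eq_zero {u : ℝ} (hu : (u : AddCircle (1 : ℝ)) = 0) :
    Int.fract u = 0 := by
  obtain ⟨k, hk⟩ := (AddCircle.coe_eq_zero_iff (1 : ℝ)).1 hu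
  rw [← hk]
  simp

lemma radialProjection_of_fract_eq_zero (hc : ∀ j, 0 < c j ∧ c j < 1) {j : ι}
    (hx : Int.fract (x j) = 0) (k : ι) : radialProjection c x k = x k := by
  rw [radialProjection, latticeRadius_eq_one hc hx, div_one, add_sub_cancel, coe_fract]

lemma exists_radialProjection_eq_zero [Nonempty ι] (hc : ∀ j, 0 < c j ∧ c j < 1)
    (hx : latticeRadius c x ≠ 0) : ∃ j, radialProjection c x j = 0 := by
  obtain ⟨j, -, hj⟩ := Finset.exists_max_image Finset.univ
    (fun j => periodicGauge (c j) (x j)) Finset.univ_nonempty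
  have hnn k := periodicGauge_nonneg (hc k).1 (hc k).2 (x k)
  have hr : latticeRadius c x = periodicGauge (c j) (x j) := by
    refine le_antisymm ((pi_norm_le_iff_of_nonneg (hnn j)).2 fun k => ?_) ?_
    · rw [Real.norm_of_nonneg (hnn k)]
      exact hj k (Finset.mem_univ k)
    · exact (le_abs_self _).trans (norm_le_pi_norm (fun j => periodicGauge (c j) (x j)) j)
  refine ⟨j, ?_⟩
  rw [radialProjection, hr]
  rcases add_div_periodicGauge (hc j).1 (hc j).2 (hr ▸ hx) with h | h
  · rw [h, AddCircle.coe_zero]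
  · rw [h, AddCircle.coe_period]

lemma continuousAt_radialProjection (hc : ∀ j, 0 < c j ∧ c j < 1) (hx : latticeRadius c x ≠ 0) :
    ContinuousAt (radialProjection c) x := by
  refine continuousAt_pi.2 fun j => ?_
  have hrad : ContinuousAt (fun y => (latticeRadius c y)⁻¹ - 1) x :=
    ((continuous_latticeRadius hc).continuousAt.inv₀ hx).sub continuousAt_const
  have hcoord : ContinuousAt (fun y : ι → ℝ => y j) x := (continuous_apply j).continuousAt
  have hdefect : ContinuousAt
      (fun y => (Int.fract (y j) - c j) * ((latticeRadius c y)⁻¹ - 1)) x := by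
    by_cases hj : Int.fract (x j) = 0
    · have hzero : (latticeRadius c x)⁻¹ - 1 = 0 := by simp [latticeRadius_eq_one hc hj]
      rw [ContinuousAt, hzero, mul_zero]
      refine bdd_le_mul_tendsto_zero (b := -1) (B := 1) (.of_forall fun y => ?_)
        (.of_forall fun y => ?_) (hzero ▸ hrad)
      · linarith [Int.fract_nonneg (y j), (hc j).2]
      · linarith [Int.fract_lt_one (y j), (hc j).1]
    · have hne : x j ≠ ⌊x j⌋ := fun h => hj (sub_eq_zero.2 h)
      exact ((ContinuousAt.comp (f := fun y : ι → ℝ => y j) (continuousAt_fract hne) hcoord).sub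
        continuousAt_const).mul hrad
  have heq : (fun y => radialProjection c y j) = fun y => ((y j +
      (Int.fract (y j) - c j) * ((latticeRadius c y)⁻¹ - 1) : ℝ) : AddCircle (1 : ℝ)) := by
    funext y
    rw [radialProjection, AddCircle.coe_add (1 : ℝ) (y j), ← coe_fract (y j), ← AddCircle.coe_add]
    congr 1
    ring
  rw [heq]
  exact (AddCircle.continuous_mk' (1 : ℝ)).continuousAt.comp (hcoord.add hdefect)

end Retraction

lemma LocallyLipschitz.exists_forall_ne_add_intCast {E ι : Type*} [NormedAddCommGroup E]
    [NormedSpace ℝ E] [FiniteDimensional ℝ E] [Fintype ι] {H : E → ι → ℝ}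
    (hH : LocallyLipschitz H) (hdim : Module.finrank ℝ E < Fintype.card ι) (x : ι → ℝ) {ε : ℝ}
    (hε : 0 < ε) : ∃ c ∈ Metric.ball x ε, ∀ (z : ι → ℤ) (e : E), H e ≠ fun j => c j + z j := by
  let S : Set (ι → ℝ) := ⋃ z : ι → ℤ, Set.range fun e => H e - fun j => (z j : ℝ)
  have hS : dimH S < Module.finrank ℝ (ι → ℝ) := by
    rw [dimH_iUnion, Module.finrank_fintype_fun_eq_card]
    refine lt_of_le_of_lt (iSup_le fun z => ?_) (Nat.cast_lt.2 hdim)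
    rw [← Real.dimH_univ_eq_finrank E]
    refine dimH_range_le_of_locally_lipschitzOn fun e => ?_
    obtain ⟨K, t, ht, hK⟩ := hH e
    exact ⟨K, t, ht, fun a ha b hb => by simpa using hK ha hb⟩
  obtain ⟨c, hc, hcS⟩ := (dense_compl_of_dimH_lt_finrank hS).exists_mem_open Metric.isOpen_ball
    ⟨x, Metric.mem_ball_self hε⟩
  refine ⟨c, hcS, fun z e he => hc (Set.mem_iUnion.2 ⟨z, e, ?_⟩)⟩
  funext j
  simp [he]

section SoftThreshold

variable {ι : Type*}

/-- Coordinatewise soft thresholding: move every coordinate towards `0` by `ε`, stopping at `0`. -/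
def softThreshold (ε : ℝ) (x : ι → ℝ) : ι → ℝ :=
  fun j => x j - max (-ε) (min (x j) ε)

lemma locallyLipschitz_softThreshold [Fintype ι] (ε : ℝ) :
    LocallyLipschitz (softThreshold ε : (ι → ℝ) → ι → ℝ) := by
  have h (j : ι) : LipschitzWith 2
      (fun x : ι → ℝ => x j - max (-ε) (min (x j) ε)) := by
    have h1 : LipschitzWith 1 (fun x : ι → ℝ => x j) := LipschitzWith.eval j
    have := h1.sub ((h1.min_const ε).const_max (-ε))
    rwa [one_add_one_eq_two] at this
  exact (LipschitzWith.of_dist_le_mul fun x y => (dist_pi_le_iff (by positivity)).2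
    fun j => (h j).dist_le_mul x y).locallyLipschitz

lemma abs_softThreshold_sub_le {ε : ℝ} (hε : 0 ≤ ε) (x : ι → ℝ) (j : ι) :
    |softThreshold ε x j - x j| ≤ ε := by
  rw [softThreshold, sub_sub_cancel_left, abs_neg, abs_le]
  exact ⟨le_max_left _ _, max_le (by linarith) (min_le_right _ _)⟩

lemma softThreshold_eq_zero {ε : ℝ} {x : ι → ℝ} {j : ι} (hx : |x j| ≤ ε) :
    softThreshold ε x j = 0 := by
  rw [abs_le] at hx
  rw [softThreshold, min_eq_left hx.2, max_eq_right hx.1, sub_self]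

end SoftThreshold

section Cube

variable {κ : Type*}

/-- The coordinatewise nearest-point projection of `ℝ^κ` to the unit cube. -/
def cubeProjection (t : κ → ℝ) : κ → I :=
  fun k => Set.projIcc 0 1 zero_le_one (t k)

lemma cubeProjection_coe (y : κ → I) : cubeProjection (fun k => (y k : ℝ)) = y :=
  funext fun k => Set.projIcc_val zero_le_one (y k)

lemma continuous_cubeProjection : Continuous (cubeProjection : (κ → ℝ) → κ → I) :=
  continuous_pi fun k => continuous_projIcc.comp (continuous_apply k)

lemma uniformContinuous_cubeProjection : UniformContinuous (cubeProjection : (κ → ℝ) → κ → I) :=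
  uniformContinuous_pi.2 fun k => (LipschitzWith.projIcc zero_le_one).uniformContinuous.comp
    (Pi.uniformContinuous_proj (fun _ : κ => ℝ) k)

lemma exists_lift_of_cube [Finite κ] (f : C(κ → I, AddCircle (1 : ℝ))) (h0 : f 0 = 0) :
    ∃ F : C(κ → I, ℝ), F 0 = 0 ∧ ∀ y, (F y : AddCircle (1 : ℝ)) = f y := by
  have : Fintype κ := Fintype.ofFinite κ
  have h0' : cubeProjection (0 : κ → ℝ) = 0 := cubeProjection_coe 0
  obtain ⟨F, ⟨hF0, hF⟩, -⟩ := (AddCircle.isCoveringMap_coe (1 : ℝ)).existsUnique_continuousMap_lifts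
    (f.comp ⟨cubeProjection, continuous_cubeProjection⟩) (0 : κ → ℝ) (0 : ℝ)
    (by simp [h0', h0])
  refine ⟨F.comp ⟨fun y k => (y k : ℝ), by fun_prop⟩, hF0, fun y => ?_⟩
  have := congrFun hF fun k => (y k : ℝ)
  simpa [cubeProjection_coe] using this

lemma isPreconnected_face (a : κ) (e : I) : IsPreconnected {y : κ → I | y a = e} := by
  classical
  have : {y : κ → I | y a = e} =
      Set.univ.pi fun k => if k = a then {e} else (Set.univ : Set I) := by
    ext y
    simp only [Set.mem_ofPred_eq, Set.mem_univ_pi]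
    refine ⟨fun h k => ?_, fun h => by simpa using h a⟩
    split_ifs with hk
    · rw [hk]; exact h
    · trivial
  rw [this]
  refine isPreconnected_univ_pi fun k => ?_
  split_ifs
  · exact isPreconnected_singleton
  · exact isPreconnected_univ

/-- A function on a cube of dimension at least two which is integral on the boundary and
vanishes at the origin vanishes on the whole boundary. -/
lemma eq_zero_of_mem_cube_boundary [Nontrivial κ] {F : (κ → I) → ℝ} (hF : Continuous F)
    (h0 : F 0 = 0) (hint : ∀ y ∈ Cube.boundary κ, ∃ m : ℤ, F y = m) {y : κ → I}
    (hy : y ∈ Cube.boundary κ) : F y = 0 := by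
  classical
  have key {a : κ} {e : I} (he : e = 0 ∨ e = 1) {u v : κ → I} (hu : u a = e) (hv : v a = e) :
      F u = F v := by
    have hd : IsDiscrete (Set.range ((↑) : ℤ → ℝ)) :=
      Int.isClosedEmbedding_coe_real.isEmbedding.isDiscrete_range
    refine (isPreconnected_face a e).constant_of_mapsTo hd hF.continuousOn (fun w hw => ?_) hu hv
    obtain ⟨m, hm⟩ := hint w ⟨a, by rwa [show w a = e from hw]⟩
    exact ⟨m, hm.symm⟩
  obtain ⟨a, ha⟩ := hy
  obtain ⟨b, hb⟩ := exists_ne a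
  rw [key (a := a) ha rfl (v := Function.update y b 0) (Function.update_of_ne hb.symm _ _),
    key (a := b) (.inl rfl) (Function.update_self _ _ _) (v := 0) rfl, h0]

end Cube

/-- A continuous map from a cube to the codimension one skeleton of the integer lattice which sends
the boundary to `0` is nullhomotopic in the complement of some translate of the lattice. The homotopy
goes straight to a nearby locally Lipschitz map and then scales that map down to `0`. -/
lemma exists_nullhomotopy_avoiding_lattice {ι κ : Type*} [Fintype ι] [Fintype κ]
    (hdim : Fintype.card κ + 1 < Fintype.card ι) {f : (κ → I) → ι → ℝ} (hf : Continuous f)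
    (hint : ∀ y, ∃ (j : ι) (m : ℤ), f y j = m) (hbd : ∀ y ∈ Cube.boundary κ, f y = 0) :
    ∃ (c : ι → ℝ) (G : I × (κ → I) → ι → ℝ), (∀ j, 0 < c j ∧ c j < 1) ∧ Continuous G ∧
      (∀ p (z : ι → ℤ), G p ≠ fun j => c j + z j) ∧ (∀ y, G (0, y) = f y) ∧
      (∀ y, G (1, y) = 0) ∧ ∀ s, ∀ y ∈ Cube.boundary κ, G (s, y) = 0 := by
  have hunif : UniformContinuous fun t => f (cubeProjection t) :=
    (CompactSpace.uniformContinuous_of_continuous hf).comp uniformContinuous_cubeProjection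
  obtain ⟨p, hp, hpf⟩ := hunif.exists_contDiff_dist_le (show (0 : ℝ) < 1 / 8 by norm_num)
  let g (y : κ → I) : ι → ℝ := softThreshold (1 / 8) (p fun k => (y k : ℝ))
  have hpf' (y : κ → I) (j : ι) : |p (fun k => (y k : ℝ)) j - f y j| ≤ 1 / 8 := by
    have := (dist_le_pi_dist _ _ j).trans (hpf fun k => (y k : ℝ)).le
    rwa [cubeProjection_coe, Real.dist_eq] at this
  have hgf (y : κ → I) (j : ι) : |g y j - f y j| ≤ 1 / 4 := by
    have h1 := abs_softThreshold_sub_le (ε := 1 / 8) (by norm_num) (p fun k => (y k : ℝ)) j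
    have h2 := abs_sub_le (g y j) (p (fun k => (y k : ℝ)) j) (f y j)
    linarith [hpf' y j]
  have hgbd (y) (hy : y ∈ Cube.boundary κ) : g y = 0 := by
    funext j
    refine softThreshold_eq_zero ?_
    simpa [hbd y hy] using hpf' y j
  have hg : Continuous g :=
    (locallyLipschitz_softThreshold _).continuous.comp (hp.continuous.comp (by fun_prop))
  let H (e : ℝ × (κ → ℝ)) : ι → ℝ := e.1 • softThreshold (1 / 8) (p e.2)
  have hH : LocallyLipschitz H := by
    have h1 : LocallyLipschitz fun e : ℝ × (ι → ℝ) => e.1 • e.2 :=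
      (contDiff_fst.smul contDiff_snd : ContDiff ℝ 1 _).locallyLipschitz
    have h2 : LocallyLipschitz fun e : ℝ × (κ → ℝ) => softThreshold (1 / 8) (p e.2) :=
      (locallyLipschitz_softThreshold _).comp
        ((hp.of_le (by exact_mod_cast le_top)).comp contDiff_snd).locallyLipschitz
    have h3 : LocallyLipschitz fun e : ℝ × (κ → ℝ) => e.1 :=
      LipschitzWith.prod_fst.locallyLipschitz
    exact h1.comp (h3.prodMk h2)
  obtain ⟨c, hc, hcH⟩ := hH.exists_forall_ne_add_intCast
    (by simpa [Module.finrank_prod, add_comm] using hdim) (fun _ => 1 / 2)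
    (show (0 : ℝ) < 1 / 4 by norm_num)
  have hc' (j : ι) : 1 / 4 < c j ∧ c j < 3 / 4 := by
    have := (dist_le_pi_dist c (fun _ => 1 / 2) j).trans_lt hc
    rw [Real.dist_eq, abs_lt] at this
    constructor <;> linarith
  refine ⟨c, fun p => max (1 - 2 * (p.1 : ℝ)) 0 • (f p.2 - g p.2) +
    min (2 - 2 * (p.1 : ℝ)) 1 • g p.2, fun j => ⟨by linarith [hc' j], by linarith [hc' j]⟩,
    by fun_prop, ?_, fun y => by norm_num, fun y => by norm_num, fun s y hy => ?_⟩
  · rintro ⟨s, y⟩ z hz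
    have hs0 := s.2.1
    have hs1 := s.2.2
    rcases le_total (s : ℝ) (1 / 2) with hs | hs
    · obtain ⟨j, m, hm⟩ := hint y
      have hj := congrFun hz j
      beta_reduce at hj
      rw [max_eq_left (by linarith), min_eq_right (by linarith)] at hj
      simp only [Pi.add_apply, Pi.smul_apply, Pi.sub_apply, smul_eq_mul, one_mul] at hj
      have hle : |2 * (s : ℝ) * (g y j - f y j)| ≤ 1 / 4 := by
        rw [abs_mul, abs_of_nonneg (by linarith)]
        exact (mul_le_of_le_one_left (abs_nonneg _) (by linarith)).trans (hgf y j)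
      have heq : c j + ((z j - m : ℤ) : ℝ) = 2 * (s : ℝ) * (g y j - f y j) := by
        push_cast
        linarith
      rw [← heq, abs_le] at hle
      have h1 : ((-1 : ℤ) : ℝ) < ((z j - m : ℤ) : ℝ) := by
        push_cast at hle ⊢
        linarith [hc' j]
      have h2 : ((z j - m : ℤ) : ℝ) < ((0 : ℤ) : ℝ) := by
        push_cast at hle ⊢
        linarith [hc' j]
      rw [Int.cast_lt] at h1 h2
      omega
    · refine hcH z (2 - 2 * (s : ℝ), fun k => (y k : ℝ)) ?_
      rw [← hz]
      simp only
      rw [max_eq_right (by linarith), min_eq_left (by linarith), zero_smul, zero_add]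
  · simp [hbd y hy, hgbd y hy]

lemma GenLoop.homotopic_const_of_torusSkeleton {ι κ : Type*} [Fintype ι] [Nonempty ι] [Fintype κ]
    [Nontrivial κ] (hdim : Fintype.card κ + 1 < Fintype.card ι)
    {x₀ : {y : ι → AddCircle (1 : ℝ) // ∃ j, y j = 0}} (hx₀ : x₀.1 = 0) (f : GenLoop κ _ x₀) :
    GenLoop.Homotopic f GenLoop.const := by
  have hfbd (y) (hy : y ∈ Cube.boundary κ) : (f y).1 = 0 := by rw [GenLoop.boundary f y hy, hx₀]
  have hzero : (0 : κ → I) ∈ Cube.boundary κ := ⟨Classical.arbitrary κ, .inl rfl⟩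
  choose F hF0 hF using fun j => exists_lift_of_cube
    (⟨fun y => (f y).1 j, (continuous_apply j).comp (continuous_subtype_val.comp f.1.continuous)⟩ :
      C(κ → I, AddCircle (1 : ℝ)))
    (by simp [hfbd 0 hzero])
  simp only [ContinuousMap.coe_mk] at hF
  have hcast {u : ℝ} (hu : (u : AddCircle (1 : ℝ)) = 0) : ∃ m : ℤ, u = m := by
    obtain ⟨m, hm⟩ := (AddCircle.coe_eq_zero_iff (1 : ℝ)).1 hu
    exact ⟨m, by simpa using hm.symm⟩
  obtain ⟨c, G, hc, hG, hGne, hG0, hG1, hGbd⟩ := exists_nullhomotopy_avoiding_lattice hdim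
    (f := fun y j => F j y) (by fun_prop)
    (fun y => by
      obtain ⟨j, hj⟩ := (f y).2
      exact ⟨j, hcast (by rw [hF, hj])⟩)
    (fun y hy => funext fun j => eq_zero_of_mem_cube_boundary (F j).continuous (hF0 j)
      (fun w hw => hcast (by rw [hF, hfbd w hw]; rfl)) hy)
  have hproj0 : radialProjection c 0 = 0 := by
    funext j
    simp [radialProjection_of_fract_eq_zero hc (x := 0) (j := j) (by simp)]
  have hrad p := latticeRadius_ne_zero hc (hGne p)
  refine ⟨⟨⟨⟨fun p => ⟨radialProjection c (G p), exists_radialProjection_eq_zero hc (hrad p)⟩, ?_⟩,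
    fun y => Subtype.ext ?_, fun y => Subtype.ext ?_⟩, fun s y hy => Subtype.ext ?_⟩⟩
  · refine Continuous.subtype_mk (continuous_iff_continuousAt.2 fun p => ?_) _
    exact ContinuousAt.comp (continuousAt_radialProjection hc (hrad p)) hG.continuousAt
  · obtain ⟨j, hj⟩ := (f y).2
    funext k
    simp only [hG0]
    rw [radialProjection_of_fract_eq_zero hc
      (fract_eq_zero_of_coe_eq_zero (u := F j y) (by rw [hF, hj])), hF]
    rfl
  · simp only [hG1]
    exact hproj0.trans hx₀.symm
  · simp only [ContinuousMap.coe_mk, hGbd _ y hy]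
    exact hproj0.trans (hfbd y hy).symm

end

/-- For `n ≥ 3` and `2 ≤ i ≤ n − 2`, the homotopy group `π_i(N₀, 0)` of the
`(n−1)`-skeleton `N₀` of the torus `(ℝ/ℤ)ⁿ` is trivial. -/
theorem stmt_15 (n : ℕ) (hn : 3 ≤ n) (i : ℕ) (hi1 : 2 ≤ i) (hi2 : i ≤ n - 2) :
    Subsingleton (HomotopyGroup.Pi i
      {y : Fin n → AddCircle (1 : ℝ) // ∃ j, y j = 0}
      ⟨0, ⟨⟨0, by omega⟩, rfl⟩⟩) := by
  refine ⟨fun a b => Quotient.inductionOn₂ a b fun f g => Quotient.sound ?_⟩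
  have : Nonempty (Fin n) := ⟨⟨0, by omega⟩⟩
  have : Nontrivial (Fin i) := Fin.nontrivial_iff_two_le.2 hi1
  have hdim : Fintype.card (Fin i) + 1 < Fintype.card (Fin n) := by
    simp only [Fintype.card_fin]
    omega
  exact (GenLoop.homotopic_const_of_torusSkeleton hdim rfl f).trans
    (GenLoop.homotopic_const_of_torusSkeleton hdim rfl g).symm
end

section
/- For every integer n ≥ 3, the (n−1)-th homotopy group π_{n−1}(N₀, y₀) at the basepoint y₀ = 0 ∈ N₀ is isomorphic (as a group) to the free abelian group on the set ℤⁿ, i.e., to the direct sum ⊕_{ℤⁿ} ℤ of copies of ℤ indexed by ℤⁿ. -/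
open scoped Topology

namespace CubicalCochain

open Filter

variable {α : Type*} {k : ℕ}

/-- The face inclusion `x_i = ε` of the cube. -/
def face (i : Fin (k + 1)) (ε : ℝ) (x : Fin k → ℝ) : Fin (k + 1) → ℝ :=
  i.insertNth (α := fun _ => ℝ) ε x

@[simp]
theorem face_apply_same (i : Fin (k + 1)) (ε : ℝ) (x : Fin k → ℝ) : face i ε x i = ε := by
  simp [face]

@[simp]
theorem face_apply_succAbove (i : Fin (k + 1)) (ε : ℝ) (x : Fin k → ℝ) (j : Fin k) :
    face i ε x (i.succAbove j) = x j := by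
  simp [face]

theorem face_mem_Icc {i : Fin (k + 1)} {ε : ℝ} (hε : ε ∈ Set.Icc (0 : ℝ) 1) {x : Fin k → ℝ}
    (hx : x ∈ Set.Icc (0 : Fin k → ℝ) 1) : face i ε x ∈ Set.Icc (0 : Fin (k + 1) → ℝ) 1 := by
  refine ⟨fun j => ?_, fun j => ?_⟩ <;> rcases Fin.eq_self_or_eq_succAbove i j with rfl | ⟨j, rfl⟩
  · simpa using hε.1
  · simpa using hx.1 j
  · simpa using hε.2
  · simpa using hx.2 j

theorem face_face (i : Fin (k + 2)) (j : Fin (k + 1)) (ε η : ℝ) (x : Fin k → ℝ) :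
    face (i.succAbove j) η (face (j.predAbove i) ε x) = face i ε (face j η x) := by
  ext l
  rcases Fin.eq_self_or_eq_succAbove i l with rfl | ⟨l, rfl⟩
  · have := face_apply_succAbove (l.succAbove j) η (face (j.predAbove l) ε x) (j.predAbove l)
    rw [Fin.succAbove_succAbove_predAbove] at this
    rw [this]
    simp
  · rcases Fin.eq_self_or_eq_succAbove j l with rfl | ⟨l, rfl⟩
    · simp
    · rw [← Fin.succAbove_succAbove_succAbove_predAbove]
      simp only [face_apply_succAbove]
      rw [Fin.succAbove_succAbove_succAbove_predAbove]
      simp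

/-- The coboundary of an integral cochain on cubes. -/
def coboundary (c : ((Fin k → ℝ) → α) → ℤ) (σ : (Fin (k + 1) → ℝ) → α) : ℤ :=
  ∑ i : Fin (k + 1), (-1) ^ (i : ℕ) * (c (σ ∘ face i 1) - c (σ ∘ face i 0))

theorem coboundary_coboundary (c : ((Fin k → ℝ) → α) → ℤ) (σ : (Fin (k + 2) → ℝ) → α) :
    coboundary (coboundary c) σ = 0 := by
  let b : Bool → ℝ := fun e => if e then 1 else 0
  let s : Bool → ℤ := fun e => if e then 1 else -1
  let T : Fin (k + 2) × Fin (k + 1) × Bool × Bool → ℤ := fun p =>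
    (-1) ^ (p.1 + p.2.1 : ℕ) * (s p.2.2.1 * s p.2.2.2) *
      c (σ ∘ face p.1 (b p.2.2.1) ∘ face p.2.1 (b p.2.2.2))
  have h1 : coboundary (coboundary c) σ = ∑ p, T p := by
    simp only [Fintype.sum_prod_type, coboundary, T, s, b, Fintype.univ_bool]
    refine Finset.sum_congr rfl fun i _ => ?_
    rw [← Finset.sum_sub_distrib, Finset.mul_sum]
    refine Finset.sum_congr rfl fun j _ => ?_
    simp only [Finset.sum_insert, Finset.mem_singleton, Finset.sum_singleton, pow_add,
      Function.comp_assoc, reduceCtorEq, not_false_eq_true, if_true, Bool.false_eq_true, if_false]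
    ring
  rw [h1]
  refine Finset.sum_involution
    (fun p _ => (p.1.succAbove p.2.1, p.2.1.predAbove p.1, p.2.2.2, p.2.2.1)) ?_ ?_ ?_ ?_
  · rintro ⟨i, j, e, f⟩ -
    have : face (i.succAbove j) (b f) ∘ face (j.predAbove i) (b e) = face i (b e) ∘ face j (b f) :=
      funext fun x => face_face i j _ _ x
    simp only [T, this, Fin.neg_one_pow_succAbove_add_predAbove]
    ring
  · rintro ⟨i, j, e, f⟩ - - h
    exact Fin.succAbove_ne i j (congrArg Prod.fst h)
  · intros; simp
  · rintro ⟨i, j, e, f⟩ -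
    simp only [Fin.succAbove_succAbove_predAbove, Prod.mk.injEq, true_and, and_true]
    apply Fin.succAbove_right_injective (p := i)
    have := Fin.succAbove_succAbove_predAbove (i.succAbove j) (j.predAbove i)
    rw [Fin.succAbove_succAbove_predAbove i j] at this
    exact this

/-- The sum of a cochain over the cubes of the uniform grid with `N` steps in each direction. -/
noncomputable def gridSum (N : ℕ) (c : ((Fin k → ℝ) → α) → ℤ) (f : (Fin k → ℝ) → α) : ℤ :=
  ∑ j : Fin k → Fin N, c fun x => f fun i => ((j i : ℝ) + x i) / N

theorem gridSum_eq_zero {N : ℕ} {c : ((Fin k → ℝ) → α) → ℤ} {f : (Fin k → ℝ) → α}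
    (h : ∀ j : Fin k → Fin N, c (fun x => f fun i => ((j i : ℝ) + x i) / N) = 0) :
    gridSum N c f = 0 :=
  Finset.sum_eq_zero fun j _ => h j

theorem grid_mem_Icc {N : ℕ} (j : Fin k → Fin N) {x : Fin k → ℝ}
    (hx : x ∈ Set.Icc (0 : Fin k → ℝ) 1) :
    (fun i => ((j i : ℝ) + x i) / N) ∈ Set.Icc (0 : Fin k → ℝ) 1 := by
  have hN (i : Fin k) : (0 : ℝ) < N := by exact_mod_cast (j i).pos
  refine ⟨fun i => ?_, fun i => ?_⟩
  · have := hx.1 i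
    simp only [Pi.zero_apply] at this ⊢
    have := hN i
    positivity
  · have h1 := hx.2 i
    have h2 : ((j i : ℕ) : ℝ) + 1 ≤ N := by exact_mod_cast (j i).isLt
    simp only [Pi.one_apply] at h1 ⊢
    rw [div_le_one (hN i)]
    linarith

/-- The alternating sum of the grid sums over the faces of a cube. -/
noncomputable def faceSum (N : ℕ) (c : ((Fin k → ℝ) → α) → ℤ) (f : (Fin (k + 1) → ℝ) → α) : ℤ :=
  ∑ i : Fin (k + 1), (-1) ^ (i : ℕ) * (gridSum N c (f ∘ face i 1) - gridSum N c (f ∘ face i 0))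

theorem gridSum_coboundary {N : ℕ} (hN : N ≠ 0) (c : ((Fin k → ℝ) → α) → ℤ)
    (f : (Fin (k + 1) → ℝ) → α) : gridSum N (coboundary c) f = faceSum N c f := by
  have hN' : (N : ℝ) ≠ 0 := by exact_mod_cast hN
  simp only [gridSum, coboundary, faceSum]
  rw [Finset.sum_comm]
  refine Finset.sum_congr rfl fun i _ => ?_
  rw [← Finset.mul_sum]
  congr 1
  let G : ℕ → ℤ := fun m => ∑ j : Fin k → Fin N,
    c fun x => f (face i ((m : ℝ) / N) fun l => ((j l : ℝ) + x l) / N)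
  have key (ε : ℝ) (m : Fin N) (j : Fin k → Fin N) (x : Fin k → ℝ) :
      (fun l => (((i.insertNth (α := fun _ => Fin N) m j) l : ℝ) + face i ε x l) / N) =
        face i (((m : ℝ) + ε) / N) fun l => ((j l : ℝ) + x l) / N := by
    ext l
    rcases Fin.eq_self_or_eq_succAbove i l with rfl | ⟨l, rfl⟩ <;> simp
  rw [← (Fin.insertNthEquiv (fun _ => Fin N) i).sum_comp, Fintype.sum_prod_type]
  simp only [Fin.insertNthEquiv_apply, Function.comp_def, key]
  have : ∀ m : Fin N, (∑ j : Fin k → Fin N,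
      ((c fun x => f (face i (((m : ℝ) + 1) / N) fun l => ((j l : ℝ) + x l) / N)) -
        c fun x => f (face i (((m : ℝ) + 0) / N) fun l => ((j l : ℝ) + x l) / N))) =
      G (m + 1) - G m := by
    intro m
    rw [Finset.sum_sub_distrib]
    simp [G]
  simp only [this]
  rw [Fin.sum_univ_eq_sum_range (fun m => G (m + 1) - G m), Finset.sum_range_sub]
  simp [G, hN']

/-- The coordinate `i` is positive on the whole unit cube. -/
def PosOn (i : ℕ) (σ : (Fin k → ℝ) → ℕ → ℝ) : Prop :=
  ∀ x ∈ Set.Icc (0 : Fin k → ℝ) 1, 0 < σ x i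

/-- The coordinate `i` is negative on the whole unit cube. -/
def NegOn (i : ℕ) (σ : (Fin k → ℝ) → ℕ → ℝ) : Prop :=
  ∀ x ∈ Set.Icc (0 : Fin k → ℝ) 1, σ x i < 0

theorem PosOn.comp_face {i : ℕ} {σ : (Fin (k + 1) → ℝ) → ℕ → ℝ} (h : PosOn i σ)
    (j : Fin (k + 1)) {ε : ℝ} (hε : ε ∈ Set.Icc (0 : ℝ) 1) : PosOn i (σ ∘ face j ε) :=
  fun _ hx => h _ (face_mem_Icc hε hx)

theorem NegOn.comp_face {i : ℕ} {σ : (Fin (k + 1) → ℝ) → ℕ → ℝ} (h : NegOn i σ)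
    (j : Fin (k + 1)) {ε : ℝ} (hε : ε ∈ Set.Icc (0 : ℝ) 1) : NegOn i (σ ∘ face j ε) :=
  fun _ hx => h _ (face_mem_Icc hε hx)

theorem NegOn.not_posOn {i : ℕ} {σ : (Fin k → ℝ) → ℕ → ℝ} (h : NegOn i σ) : ¬ PosOn i σ :=
  fun h' => lt_asymm (h 0 (by simp)) (h' 0 (by simp))

open Classical in
/-- The degree cochain: a cocycle on those cubes on which some coordinate has a constant sign. -/
noncomputable def degreeCochain : (k : ℕ) → ((Fin k → ℝ) → ℕ → ℝ) → ℤ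
  | 0, σ => if PosOn 0 σ then 1 else 0
  | k + 1, σ => if PosOn (k + 1) σ then coboundary (degreeCochain k) σ else 0

theorem degreeCochain_of_not_posOn {σ : (Fin k → ℝ) → ℕ → ℝ} (h : ¬ PosOn k σ) :
    degreeCochain k σ = 0 := by
  cases k <;> simp [degreeCochain, h]

theorem coboundary_degreeCochain {i : ℕ} (hi : i ≤ k) {σ : (Fin (k + 1) → ℝ) → ℕ → ℝ}
    (h : PosOn i σ ∨ NegOn i σ) : coboundary (degreeCochain k) σ = 0 := by
  have h0 : (0 : ℝ) ∈ Set.Icc (0 : ℝ) 1 := by simp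
  have h1 : (1 : ℝ) ∈ Set.Icc (0 : ℝ) 1 := by simp
  induction k with
  | zero =>
    obtain rfl : i = 0 := by omega
    rcases h with h | h
    · rw [coboundary, Fin.sum_univ_one, degreeCochain, degreeCochain, if_pos (h.comp_face 0 h1),
        if_pos (h.comp_face 0 h0)]
      simp
    · rw [coboundary, Fin.sum_univ_one, degreeCochain_of_not_posOn (h.comp_face 0 h1).not_posOn,
        degreeCochain_of_not_posOn (h.comp_face 0 h0).not_posOn]
      simp
  | succ k ih =>
    rcases hi.lt_or_eq with hi | rfl
    · refine Finset.sum_eq_zero fun j _ => ?_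
      have : ∀ ε ∈ Set.Icc (0 : ℝ) 1, degreeCochain (k + 1) (σ ∘ face j ε) = 0 := fun ε hε => by
        rw [degreeCochain, ih (by omega) (h.imp (·.comp_face j hε) (·.comp_face j hε)), ite_self]
      rw [this 0 h0, this 1 h1]; simp
    · rcases h with h | h
      · rw [← coboundary_coboundary (degreeCochain k) σ]
        refine Finset.sum_congr rfl fun j _ => ?_
        rw [degreeCochain, degreeCochain, if_pos (h.comp_face j h1), if_pos (h.comp_face j h0)]
      · refine Finset.sum_eq_zero fun j _ => ?_
        rw [degreeCochain_of_not_posOn (h.comp_face _ h0).not_posOn,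
          degreeCochain_of_not_posOn (h.comp_face _ h1).not_posOn]
        simp

theorem degreeCochain_eq_zero {i : ℕ} (hi : i < k) {σ : (Fin k → ℝ) → ℕ → ℝ}
    (h : PosOn i σ ∨ NegOn i σ) : degreeCochain k σ = 0 := by
  cases k with
  | zero => omega
  | succ k => rw [degreeCochain, coboundary_degreeCochain (by omega) h, ite_self]

theorem gridSum_degreeCochain_const {N : ℕ} (hk : k ≠ 0) (v : ℕ → ℝ) :
    gridSum N (degreeCochain k) (fun _ => v) = 0 := by
  refine gridSum_eq_zero fun j => ?_
  cases k with
  | zero => omega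
  | succ k => simp [degreeCochain, coboundary, Function.comp_def]

theorem eventually_faceSum_eq_zero {F : (Fin (k + 1) → ℝ) → ℕ → ℝ} (hF : Continuous F)
    (h : ∀ x ∈ Set.Icc (0 : Fin (k + 1) → ℝ) 1, ∃ i ≤ k, F x i ≠ 0) :
    ∀ᶠ N in atTop, faceSum N (degreeCochain k) F = 0 := by
  let U : Fin (k + 1) × Bool → Set (Fin (k + 1) → ℝ) := fun p =>
    {x | if p.2 then 0 < F x p.1 else F x p.1 < 0}
  have hU : ∀ p, IsOpen (U p) := by
    rintro ⟨i, e⟩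
    have := (continuous_apply (i : ℕ)).comp hF
    cases e
    · simpa [U] using isOpen_lt this continuous_const
    · simpa [U] using isOpen_lt continuous_const this
  obtain ⟨δ, hδ, hball⟩ := lebesgue_number_lemma_of_metric (isCompact_Icc (a := (0 : Fin (k+1) → ℝ))
    (b := 1)) hU (fun x hx => by
      obtain ⟨i, hi, hx⟩ := h x hx
      rw [Set.mem_iUnion]
      rcases lt_or_gt_of_ne hx with hx | hx
      · exact ⟨(⟨i, by omega⟩, false), by simpa [U] using hx⟩
      · exact ⟨(⟨i, by omega⟩, true), by simpa [U] using hx⟩)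
  obtain ⟨M, hM⟩ := exists_nat_gt (1 / δ)
  filter_upwards [eventually_gt_atTop M] with N hN
  have hN0 : N ≠ 0 := by omega
  have hNpos : (0 : ℝ) < N := by exact_mod_cast Nat.pos_of_ne_zero hN0
  have hNδ : 1 / (N : ℝ) < δ := by
    rw [div_lt_iff₀ hNpos, mul_comm, ← div_lt_iff₀ hδ]
    exact hM.trans (by exact_mod_cast hN)
  rw [← gridSum_coboundary hN0]
  refine gridSum_eq_zero fun j => ?_
  obtain ⟨⟨i, e⟩, hp⟩ := hball _ (grid_mem_Icc j (x := 0) (by simp))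
  refine coboundary_degreeCochain (i := i) (by omega) ?_
  have key : ∀ x ∈ Set.Icc (0 : Fin (k + 1) → ℝ) 1,
      (fun l => ((j l : ℝ) + x l) / N) ∈ U (i, e) := fun x hx => hp <| by
    rw [Metric.mem_ball, dist_pi_lt_iff hδ]
    intro l
    have h1 := hx.1 l
    have h2 := hx.2 l
    simp only [Pi.zero_apply, Pi.one_apply] at h1 h2
    rw [Real.dist_eq, ← sub_div, Pi.zero_apply, add_zero, add_sub_cancel_left,
      abs_of_nonneg (by positivity)]
    exact (div_le_div_of_nonneg_right h2 hNpos.le).trans_lt hNδ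
  cases e
  · right; intro x hx; simpa [U] using key x hx
  · left; intro x hx; simpa [U] using key x hx

/-- The face of the cube `[-1, 1] ^ (k + 1)` on which the last coordinate is `1`. -/
def standardFace (k : ℕ) (x : Fin k → ℝ) (i : ℕ) : ℝ :=
  if h : i < k then 2 * x ⟨i, h⟩ - 1 else 1

theorem gridSum_standardFace_succ {N : ℕ} (hN : N ≠ 0) :
    gridSum N (degreeCochain (k + 1)) (standardFace (k + 1)) =
      (-1) ^ k * gridSum N (degreeCochain k) (standardFace k) := by
  have h1 : gridSum N (degreeCochain (k + 1)) (standardFace (k + 1)) =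
      gridSum N (coboundary (degreeCochain k)) (standardFace (k + 1)) :=
    Finset.sum_congr rfl fun j _ => by
      rw [degreeCochain, if_pos]
      intro x _
      simp [standardFace]
  rw [h1, gridSum_coboundary hN, faceSum, Fin.sum_univ_castSucc, Finset.sum_eq_zero, zero_add]
  · have h2 : gridSum N (degreeCochain k) (standardFace (k + 1) ∘ face (Fin.last k) 0) = 0 :=
      gridSum_eq_zero fun j => degreeCochain_of_not_posOn fun h => by
        have := h 0 (by simp)
        have e : face (Fin.last k) 0 (fun i => ((j i : ℝ) + (0 : Fin k → ℝ) i) / N)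
          ⟨k, by omega⟩ = 0 := face_apply_same (Fin.last k) _ _
        simp only [standardFace, Function.comp, lt_add_iff_pos_right, zero_lt_one, dif_pos, e] at this
        norm_num at this
    have h3 : standardFace (k + 1) ∘ face (Fin.last k) 1 = standardFace k := by
      ext x i
      simp only [standardFace, Function.comp]
      rcases lt_trichotomy i k with hi | rfl | hi
      · rw [dif_pos hi, dif_pos (by omega)]
        have : face (Fin.last k) 1 x ⟨i, by omega⟩ = x ⟨i, hi⟩ := by
          simpa using face_apply_succAbove (Fin.last k) 1 x ⟨i, hi⟩
        rw [this]
      · have : face (Fin.last i) 1 x ⟨i, by omega⟩ = 1 := face_apply_same (Fin.last i) _ _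
        simp [this]; norm_num
      · rw [dif_neg (by omega), dif_neg (by omega)]
    rw [h2, h3]; simp
  · intro i _
    have : ∀ ε : ℝ, ε = 0 ∨ ε = 1 →
        gridSum N (degreeCochain k) (standardFace (k + 1) ∘ face i.castSucc ε) = 0 := by
      intro ε hε
      refine gridSum_eq_zero fun j => degreeCochain_eq_zero (i := i) i.isLt ?_
      have e (y : Fin k → ℝ) : standardFace (k + 1) (face i.castSucc ε y) i = 2 * ε - 1 := by
        have : face i.castSucc ε y ⟨i, by omega⟩ = ε := face_apply_same i.castSucc _ _
        simp [standardFace, this, show (i : ℕ) < k + 1 by omega]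
      rcases hε with rfl | rfl
      · right; intro x _; simp only [Function.comp, e]; norm_num
      · left; intro x _; simp only [Function.comp, e]; norm_num
    rw [this 0 (.inl rfl), this 1 (.inr rfl)]; simp

theorem gridSum_standardFace_ne_zero {N : ℕ} (hN : N ≠ 0) :
    gridSum N (degreeCochain k) (standardFace k) ≠ 0 := by
  induction k with
  | zero => simp [gridSum, degreeCochain, PosOn, standardFace]
  | succ k ih =>
    rw [gridSum_standardFace_succ hN]
    exact mul_ne_zero (pow_ne_zero _ (by norm_num)) ih

end CubicalCochain

namespace GenLoop

open scoped unitInterval Topology.Homotopy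
open Filter CubicalCochain

variable {N X : Type*} [TopologicalSpace X] {x : X}

theorem homotopic_of_continuous {f g : Ω^ N X x} (H : I → (N → I) → X) (hH : Continuous ↿H)
    (h0 : ∀ y, H 0 y = f y) (h1 : ∀ y, H 1 y = g y)
    (hb : ∀ s, ∀ y ∈ Cube.boundary N, H s y = x) : Homotopic f g :=
  ⟨{ toFun := fun p => H p.1 p.2
     continuous_toFun := hH
     map_zero_left := h0
     map_one_left := h1
     prop' := fun s y hy => (hb s y hy).trans (f.2 y hy).symm }⟩

/-- The coordinatewise projection of a real vector space onto the unit cube. -/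
noncomputable def clamp (y : N → ℝ) : N → I := fun i => Set.projIcc 0 1 zero_le_one (y i)

theorem continuous_clamp : Continuous (clamp : (N → ℝ) → N → I) :=
  continuous_pi fun _ => continuous_projIcc.comp (continuous_apply _)

@[simp]
theorem clamp_coe (y : N → I) : clamp (fun i => (y i : ℝ)) = y :=
  funext fun _ => Set.projIcc_val _ _

theorem clamp_mem_boundary {y : N → ℝ} {i : N} (hy : y i ≤ 0 ∨ 1 ≤ y i) :
    clamp y ∈ Cube.boundary N :=
  ⟨i, hy.imp (Set.projIcc_of_le_left _) (Set.projIcc_of_right_le _)⟩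

/-- The extension of a generalized loop from the unit cube to the whole real vector space. -/
noncomputable def extend (f : Ω^ N X x) (y : N → ℝ) : X := f (clamp y)

theorem continuous_extend (f : Ω^ N X x) : Continuous (extend f) :=
  f.1.continuous.comp continuous_clamp

theorem extend_coe (f : Ω^ N X x) (y : N → I) : extend f (fun i => (y i : ℝ)) = f y := by
  rw [extend, clamp_coe]

theorem extend_eq (f : Ω^ N X x) {y : N → ℝ} (i : N) (hy : y i ≤ 0 ∨ 1 ≤ y i) :
    extend f y = x :=
  f.2 _ (clamp_mem_boundary hy)

variable [DecidableEq N]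

theorem extend_update_clamp (f : Ω^ N X x) (i : N) (y : N → ℝ) :
    extend f (Function.update y i (clamp y i)) = extend f y := by
  refine congrArg f (funext fun j => ?_)
  rcases eq_or_ne j i with rfl | hj
  · simp [clamp]
  · simp [clamp, hj]

theorem extend_transAt (i : N) (f g : Ω^ N X x) (y : N → ℝ) :
    extend (transAt i f g) y =
      if (clamp y i : ℝ) ≤ 1 / 2 then extend f (Function.update y i (2 * clamp y i))
      else extend g (Function.update y i (2 * clamp y i - 1)) := by
  have key (r : ℝ) : Function.update (clamp y) i (Set.projIcc 0 1 zero_le_one r) =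
      clamp (Function.update y i r) := by
    ext j
    rcases eq_or_ne j i with rfl | hj
    · simp [clamp]
    · simp [clamp, hj]
  simp only [extend, ← key]
  rfl

section Degree

variable {k : ℕ} (Q : X → ℕ → ℝ)

/-- The degree of a generalized loop in `X`, measured by a nowhere vanishing map `Q`. -/
noncomputable def degree (f : Ω^ (Fin k) X x) : (atTop : Filter ℕ).Germ ℤ :=
  ((fun N => gridSum N (degreeCochain k) (Q ∘ extend f) : ℕ → ℤ) : (atTop : Filter ℕ).Germ ℤ)

variable {Q}

theorem degree_eq_of_homotopic (hQ : Continuous Q) (hQ0 : ∀ p, ∃ i ≤ k, Q p i ≠ 0)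
    {f g : Ω^ (Fin k) X x} (h : Homotopic f g) : degree Q f = degree Q g := by
  obtain ⟨H⟩ := h
  let F : (Fin (k + 1) → ℝ) → ℕ → ℝ := fun z =>
    Q (H (Set.projIcc 0 1 zero_le_one (z 0), clamp (Fin.tail z)))
  have hF : Continuous F := by
    refine hQ.comp (H.continuous.comp (.prodMk (continuous_projIcc.comp (continuous_apply 0))
      (continuous_clamp.comp (continuous_pi fun i => ?_))))
    exact continuous_apply i.succ
  refine Germ.coe_eq.2 ((eventually_faceSum_eq_zero hF fun z _ => hQ0 _).mono fun N hN => ?_)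
  rw [faceSum, Fin.sum_univ_succ, Finset.sum_eq_zero, add_zero] at hN
  · have e0 : F ∘ face 0 0 = Q ∘ extend f := by
      ext1 y
      simp [F, face, extend, Fin.tail_def]
    have e1 : F ∘ face 0 1 = Q ∘ extend g := by
      ext1 y
      simp [F, face, extend, Fin.tail_def]
    rw [e0, e1] at hN
    simp at hN
    show gridSum _ _ _ = gridSum _ _ _
    omega
  · intro i _
    have : ∀ ε : ℝ, ε ≤ 0 ∨ 1 ≤ ε → F ∘ face i.succ ε = fun _ => Q x := by
      intro ε hε
      ext1 y
      have hb : clamp (Fin.tail (face i.succ ε y)) ∈ Cube.boundary (Fin k) :=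
        clamp_mem_boundary (i := i) (by simpa [Fin.tail_def] using hε)
      have := H.prop' (Set.projIcc 0 1 zero_le_one (face i.succ ε y 0)) _ hb
      exact congrArg Q (this.trans (f.2 _ hb))
    rw [this 0 (.inl le_rfl), this 1 (.inr le_rfl)]
    simp

theorem degree_transAt {m : ℕ} {Q : X → ℕ → ℝ} (hQ : Continuous Q)
    (hQ0 : ∀ p, ∃ i ≤ m + 1, Q p i ≠ 0) (f g : Ω^ (Fin (m + 1)) X x) :
    degree Q (transAt 0 f g) = degree Q f + degree Q g := by
  let Φ : ℝ × (Fin (m + 1) → ℝ) → X := fun p =>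
    if p.1 ≤ 1 then extend f (Function.update p.2 0 p.1)
      else extend g (Function.update p.2 0 (p.1 - 1))
  have hΦ : Continuous Φ := by
    refine Continuous.if_le ?_ ?_ continuous_fst continuous_const ?_
    · exact (continuous_extend f).comp (continuous_snd.update 0 continuous_fst)
    · exact (continuous_extend g).comp
        (continuous_snd.update 0 (continuous_fst.sub continuous_const))
    · intro p hp
      rw [extend_eq f 0 (by simp [hp]), extend_eq g 0 (by simp [hp])]
  have hΦ0 (r : ℝ) (y) (j : Fin (m + 1)) (hj : j ≠ 0) (hy : y j ≤ 0 ∨ 1 ≤ y j) :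
      Φ (r, y) = x := by
    simp only [Φ]
    rw [extend_eq f j (by simpa [hj] using hy), extend_eq g j (by simpa [hj] using hy), ite_self]
  let F : (Fin (m + 2) → ℝ) → ℕ → ℝ := fun z =>
    Q (Φ (2 * clamp z 1 + clamp z 0 - clamp z 0 * clamp z 1, Fin.tail z))
  have hF : Continuous F := by
    refine hQ.comp (hΦ.comp (.prodMk ?_ (continuous_pi fun i => ?_)))
    · have hc (i : Fin (m + 2)) : Continuous fun z : Fin (m + 2) → ℝ => (clamp z i : ℝ) :=
        continuous_subtype_val.comp ((continuous_apply i).comp continuous_clamp)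
      exact ((continuous_const.mul (hc 1)).add (hc 0)).sub ((hc 0).mul (hc 1))
    · exact continuous_apply i.succ
  refine Germ.coe_eq.2 ((eventually_faceSum_eq_zero hF fun z _ => hQ0 _).mono fun N hN => ?_)
  rw [faceSum, Fin.sum_univ_succ, Fin.sum_univ_succ, Finset.sum_eq_zero, add_zero] at hN
  · have hp0 : ((Set.projIcc 0 1 zero_le_one 0 : I) : ℝ) = 0 := by simp
    have hp1 : ((Set.projIcc 0 1 zero_le_one 1 : I) : ℝ) = 1 := by simp
    have h0 (ε : ℝ) (y : Fin (m + 1) → ℝ) : clamp (face 0 ε y) 0 = Set.projIcc 0 1 zero_le_one ε := by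
      simp [clamp]
    have h1 (ε : ℝ) (y : Fin (m + 1) → ℝ) : clamp (face 0 ε y) 1 = clamp y 0 := by
      simpa [clamp] using congrArg (Set.projIcc (0 : ℝ) 1 zero_le_one)
        (face_apply_succAbove 0 ε y 0)
    have e0 : F ∘ face 0 0 = Q ∘ extend (transAt 0 f g) := by
      ext1 y
      simp only [F, Φ, Function.comp, extend_transAt, h0, h1]
      have h2 : Fin.tail (face 0 0 y) = y := by simp [face]
      rw [h2, hp0, zero_mul, sub_zero, add_zero]
      exact congrArg Q (if_congr (by constructor <;> intro <;> linarith) rfl rfl)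
    have e1 : F ∘ face 0 1 = Q ∘ extend g := by
      ext1 y
      simp only [F, Φ, Function.comp, h0, h1]
      have h2 : Fin.tail (face 0 1 y) = y := by simp [face]
      rw [h2, hp1, one_mul,
        show 2 * (clamp y 0 : ℝ) + 1 - clamp y 0 = clamp y 0 + 1 by ring, add_sub_cancel_right,
        extend_update_clamp]
      split_ifs with h
      · rw [extend_eq f 0 (.inr (by simpa using (clamp y 0).2.1)), ← extend_update_clamp g 0,
          extend_eq g 0 (.inl (by simpa using h))]
      · rfl
    have h3 (ε : ℝ) (y : Fin (m + 1) → ℝ) : clamp (face (Fin.succ 0) ε y) 1 = Set.projIcc 0 1 zero_le_one ε := by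
      exact congrArg (Set.projIcc (0 : ℝ) 1 zero_le_one) (face_apply_same (Fin.succ 0) ε y)
    have h4 (ε : ℝ) (y : Fin (m + 1) → ℝ) : clamp (face (Fin.succ 0) ε y) 0 = clamp y 0 := by
      simpa [clamp] using congrArg (Set.projIcc (0 : ℝ) 1 zero_le_one)
        (face_apply_succAbove (Fin.succ 0) ε y 0)
    have h5 (ε : ℝ) (y : Fin (m + 1) → ℝ) (r : ℝ) :
        Function.update (Fin.tail (face (Fin.succ 0) ε y)) 0 r = Function.update y 0 r := by
      ext j
      rcases Fin.eq_zero_or_eq_succ j with rfl | ⟨j, rfl⟩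
      · simp
      · have := face_apply_succAbove (Fin.succ 0) ε y j.succ
        rw [Fin.succ_succAbove_succ, Fin.zero_succAbove] at this
        simpa [Fin.tail_def] using this
    have e2 : F ∘ face (Fin.succ 0) 0 = Q ∘ extend f := by
      ext1 y
      simp only [F, Φ, Function.comp, h3, h4, h5]
      rw [hp0, mul_zero, zero_add, mul_zero, sub_zero,
        if_pos (clamp y 0).2.2, extend_update_clamp]
    have e3 : F ∘ face (Fin.succ 0) 1 = fun _ => Q x := by
      ext1 y
      simp only [F, Φ, Function.comp, h3, h4, h5]
      rw [hp1, mul_one, mul_one, add_sub_cancel_right,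
        if_neg (by norm_num), extend_eq g 0 (by simp; norm_num)]
    rw [e0, e1, e2, e3, gridSum_degreeCochain_const m.succ_ne_zero] at hN
    simp at hN
    show gridSum _ _ _ = gridSum _ _ _ + gridSum _ _ _
    omega
  · intro i _
    have : ∀ ε : ℝ, ε ≤ 0 ∨ 1 ≤ ε → F ∘ face i.succ.succ ε = fun _ => Q x := by
      intro ε hε
      ext1 y
      exact congrArg Q (hΦ0 _ _ i.succ (Fin.succ_ne_zero i) (by simpa [Fin.tail_def] using hε))
    rw [this 0 (.inl le_rfl), this 1 (.inr le_rfl)]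
    simp

/-- The degree as a group homomorphism. -/
noncomputable def degreeHom {m : ℕ} (Q : X → ℕ → ℝ) (hQ : Continuous Q)
    (hQ0 : ∀ p, ∃ i ≤ m + 1, Q p i ≠ 0) :
    HomotopyGroup (Fin (m + 1)) X x →* Multiplicative ((atTop : Filter ℕ).Germ ℤ) :=
  MonoidHom.mk' (fun a => Multiplicative.ofAdd (Quotient.liftOn a (degree Q)
      fun _ _ h => degree_eq_of_homotopic hQ hQ0 h)) <| by
    rintro ⟨f⟩ ⟨g⟩
    have h := HomotopyGroup.mul_spec (i := 0) (p := f) (q := g)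
    refine (congrArg (fun a => Multiplicative.ofAdd (Quotient.liftOn a (degree Q)
      fun _ _ h => degree_eq_of_homotopic hQ hQ0 h)) h).trans ?_
    change Multiplicative.ofAdd (degree Q _) = _
    rw [degree_transAt hQ hQ0, add_comm]
    rfl

end Degree

end GenLoop

namespace Grid

open scoped unitInterval Topology.Homotopy
open GenLoop Set

variable {k : ℕ}

/-- The union of the integral coordinate hyperplanes in `ℝ^k × ℝ`. -/
def gridSet (k : ℕ) : Set ((Fin k → ℝ) × ℝ) :=
  {p | (∃ i, ∃ z : ℤ, p.1 i = z) ∨ ∃ z : ℤ, p.2 = z}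

theorem zero_mem_gridSet : (0 : (Fin k → ℝ) × ℝ) ∈ gridSet k := .inr ⟨0, by simp⟩

/-- The origin as a point of the grid. -/
def origin (k : ℕ) : gridSet k := ⟨0, zero_mem_gridSet⟩

/-- A map on real vectors that represents a generalized loop in the grid based at the origin. -/
structure IsLoop (f : (Fin k → ℝ) → (Fin k → ℝ) × ℝ) : Prop where
  continuous : Continuous f
  mem : ∀ x, f x ∈ gridSet k
  zero : ∀ x i, x i ≤ 0 ∨ 1 ≤ x i → f x = 0

namespace IsLoop

variable {f g : (Fin k → ℝ) → (Fin k → ℝ) × ℝ}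

/-- The generalized loop represented by a map. -/
def genLoop (hf : IsLoop f) : Ω^ (Fin k) (gridSet k) (origin k) :=
  ⟨⟨fun y => ⟨f fun i => y i, hf.mem _⟩, (hf.continuous.comp (by fun_prop)).subtype_mk _⟩,
    fun _ ⟨i, hi⟩ => Subtype.ext (hf.zero _ i (by
      rcases hi with hi | hi
      · left; simp [hi]
      · right; simp [hi]))⟩

/-- The class in the homotopy group represented by a map. -/
def cls (hf : IsLoop f) : HomotopyGroup (Fin k) (gridSet k) (origin k) := ⟦hf.genLoop⟧

theorem genLoop_apply (hf : IsLoop f) (y : Fin k → I) : (hf.genLoop y).1 = f fun i => y i :=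
  rfl

theorem cls_eq (hf : IsLoop f) (hg : IsLoop g) (H : ℝ → (Fin k → ℝ) → (Fin k → ℝ) × ℝ)
    (hH : Continuous fun p : ℝ × (Fin k → ℝ) => H p.1 p.2)
    (h : ∀ s ∈ Icc (0 : ℝ) 1, ∀ x, H s x ∈ gridSet k)
    (h' : ∀ s ∈ Icc (0 : ℝ) 1, ∀ x i, x i ≤ 0 ∨ 1 ≤ x i → H s x = 0)
    (h0 : ∀ x, H 0 x = f x) (h1 : ∀ x, H 1 x = g x) : hf.cls = hg.cls := by
  refine Quotient.sound (homotopic_of_continuous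
    (fun s y => ⟨H s fun i => y i, h s s.2 _⟩) ?_ ?_ ?_ ?_)
  · exact (hH.comp (by fun_prop : Continuous fun p : I × (Fin k → I) =>
      ((p.1 : ℝ), fun i => (p.2 i : ℝ)))).subtype_mk _
  · exact fun y => Subtype.ext ((congrArg (H · _) (by simp)).trans (h0 _))
  · exact fun y => Subtype.ext ((congrArg (H · _) (by simp)).trans (h1 _))
  · rintro s y ⟨i, hi⟩
    refine Subtype.ext (h' s s.2 _ i ?_)
    rcases hi with hi | hi
    · left; simp [hi]
    · right; simp [hi]

theorem cls_congr (hf : IsLoop f) (hg : IsLoop g) (h : ∀ x, f x = g x) : hf.cls = hg.cls := by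
  obtain rfl : f = g := funext h
  rfl

end IsLoop

theorem isLoop_extend (f : Ω^ (Fin k) (gridSet k) (origin k)) :
    IsLoop fun x => (extend f x).1 :=
  ⟨continuous_subtype_val.comp (continuous_extend f), fun x => (extend f x).2,
    fun _ i hx => congrArg Subtype.val (extend_eq f i hx)⟩

theorem cls_extend (f : Ω^ (Fin k) (gridSet k) (origin k)) : (isLoop_extend f).cls = ⟦f⟧ :=
  congrArg _ (GenLoop.ext _ _ fun y => Subtype.ext (congrArg Subtype.val (extend_coe f y)))

theorem isLoop_zero : IsLoop fun _ : Fin k → ℝ => (0 : (Fin k → ℝ) × ℝ) :=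
  ⟨continuous_const, fun _ => zero_mem_gridSet, fun _ _ _ => rfl⟩

theorem cls_zero {d : ℕ} : (isLoop_zero (k := d + 1)).cls = 1 := rfl

theorem IsLoop.comp_reflect {f : (Fin k → ℝ) → (Fin k → ℝ) × ℝ} (hf : IsLoop f) (i : Fin k) :
    IsLoop fun x => f (Function.update x i (1 - x i)) := by
  refine ⟨hf.continuous.comp (by fun_prop), fun _ => hf.mem _, fun x j hx => hf.zero _ j ?_⟩
  rcases eq_or_ne j i with rfl | hj
  · rcases hx with hx | hx
    · right; simpa using hx
    · left; simpa using hx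
  · simpa [hj] using hx

theorem IsLoop.cls_comp_reflect {d : ℕ} {f : (Fin (d + 1) → ℝ) → (Fin (d + 1) → ℝ) × ℝ}
    (hf : IsLoop f) (i : Fin (d + 1)) : (hf.comp_reflect i).cls = hf.cls⁻¹ := by
  refine Eq.trans ?_ (HomotopyGroup.inv_spec (i := i) (p := hf.genLoop)).symm
  refine congrArg _ (GenLoop.ext _ _ fun y => Subtype.ext ?_)
  refine congrArg f (funext fun j => ?_)
  rcases eq_or_ne j i with rfl | hj
  · simp
  · simp [hj]

theorem IsLoop.cut_le {f : (Fin k → ℝ) → (Fin k → ℝ) × ℝ} (hf : IsLoop f) {i : Fin k} {a : ℝ}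
    (h : ∀ x, x i = a → f x = 0) : IsLoop fun x => if x i ≤ a then f x else 0 := by
  refine ⟨Continuous.if_le hf.continuous continuous_const (continuous_apply i) continuous_const h,
    fun x => ?_, fun x j hx => ?_⟩
  · split_ifs
    exacts [hf.mem x, zero_mem_gridSet]
  · simp [hf.zero x j hx]

theorem IsLoop.cut_ge {f : (Fin k → ℝ) → (Fin k → ℝ) × ℝ} (hf : IsLoop f) {i : Fin k} {a : ℝ}
    (h : ∀ x, x i = a → f x = 0) : IsLoop fun x => if a ≤ x i then f x else 0 := by
  refine ⟨Continuous.if_le hf.continuous continuous_const continuous_const (continuous_apply i)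
    fun x hx => h x hx.symm, fun x => ?_, fun x j hx => ?_⟩
  · split_ifs
    exacts [hf.mem x, zero_mem_gridSet]
  · simp [hf.zero x j hx]

theorem IsLoop.cls_eq_mul {d : ℕ} {f : (Fin (d + 1) → ℝ) → (Fin (d + 1) → ℝ) × ℝ}
    (hf : IsLoop f) {i : Fin (d + 1)} {a : ℝ} (ha : a ∈ Icc (0 : ℝ) 1)
    (h : ∀ x, x i = a → f x = 0) : hf.cls = (hf.cut_ge h).cls * (hf.cut_le h).cls := by
  refine Eq.trans (Eq.symm ?_) (HomotopyGroup.mul_spec (i := i) (p := (hf.cut_ge h).genLoop)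
    (q := (hf.cut_le h).genLoop)).symm
  let r : ℝ → ℝ → ℝ := fun u s => min ((1 - u) * min (2 * s) 1 + u * s)
    (max ((1 - u) * max (2 * s - 1) 0 + u * s) a)
  let H : ℝ → (Fin (d + 1) → ℝ) → (Fin (d + 1) → ℝ) × ℝ := fun u x =>
    f (Function.update x i (r u (x i)))
  have hH : Continuous ↿H := by
    refine hf.continuous.comp (continuous_snd.update i ?_)
    simp only [r]
    fun_prop
  refine Quotient.sound (homotopic_of_continuous
    (fun s y => ⟨H s fun i => y i, hf.mem _⟩) ?_ ?_ ?_ ?_)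
  · have : Continuous fun p : I × (Fin (d + 1) → I) => ↿H ((p.1 : ℝ), fun i => (p.2 i : ℝ)) :=
      hH.comp (by fun_prop)
    exact this.subtype_mk _
  · intro y
    refine Subtype.ext ?_
    have hup (t : ℝ) (ht : t ∈ Icc (0 : ℝ) 1) :
        (fun j => ((Function.update y i (projIcc 0 1 zero_le_one t) j : I) : ℝ)) =
          Function.update (fun j => (y j : ℝ)) i t := by
      ext j
      rcases eq_or_ne j i with rfl | hj
      · simp [projIcc_of_mem zero_le_one ht]
      · simp [hj]
    have hy0 := (y i).2.1
    have hy1 := (y i).2.2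
    change H ((0 : I) : ℝ) _ = ((if (y i : ℝ) ≤ 1 / 2 then _ else _ : gridSet (d + 1))).1
    split_ifs with hy
    · rw [IsLoop.genLoop_apply, hup _ ⟨by linarith, by linarith⟩]
      simp only [H, r, Icc.coe_zero, Function.update_self]
      rw [min_eq_left (by linarith : 2 * (y i : ℝ) ≤ 1),
        max_eq_right (by linarith : 2 * (y i : ℝ) - 1 ≤ 0), mul_zero, zero_mul, sub_zero, one_mul,
        add_zero, add_zero, max_eq_right ha.1]
      split_ifs with hya
      · rw [min_eq_left hya]
      · rw [min_eq_right (not_le.1 hya).le, h _ (by simp)]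
    · rw [IsLoop.genLoop_apply, hup _ ⟨by linarith, by linarith⟩]
      simp only [H, r, Icc.coe_zero, Function.update_self]
      rw [min_eq_right (by linarith : 1 ≤ 2 * (y i : ℝ)),
        max_eq_left (by linarith : 0 ≤ 2 * (y i : ℝ) - 1), sub_zero, one_mul, zero_mul, add_zero,
        one_mul, add_zero, min_eq_right (max_le (by linarith) ha.2)]
      split_ifs with hya
      · rw [max_eq_left hya]
      · rw [max_eq_right (not_le.1 hya).le, h _ (by simp)]
  · intro y
    refine Subtype.ext (congrArg f ?_)
    simp [r]
  · rintro s y ⟨j, hj⟩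
    refine Subtype.ext (hf.zero _ j ?_)
    rcases eq_or_ne j i with rfl | hji
    · rcases hj with hj | hj
      · left; simp [r, hj, ha.1]
      · right
        have : (1 - (s : ℝ)) * (2 - 1) + s = 1 := by ring
        simp [r, hj, this]
    · rcases hj with hj | hj
      · left; simp [hji, hj]
      · right; simp [hji, hj]

end Grid

namespace Grid

open Set

variable {k : ℕ}

/-- The projection of the real line onto the unit interval. -/
def clip (r : ℝ) : ℝ := max 0 (min 1 r)

/-- The projection of the real line onto `[-1/2, 1/2]`. -/
noncomputable def half (r : ℝ) : ℝ := max (-(1 / 2)) (min (1 / 2) r)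

@[fun_prop]
theorem continuous_clip : Continuous clip := by unfold clip; fun_prop

@[fun_prop]
theorem continuous_half : Continuous half := by unfold half; fun_prop

theorem clip_of_nonpos {r : ℝ} (h : r ≤ 0) : clip r = 0 :=
  max_eq_left ((min_le_right _ _).trans h)

theorem clip_of_one_le {r : ℝ} (h : 1 ≤ r) : clip r = 1 := by
  rw [clip, min_eq_left h, max_eq_right zero_le_one]

theorem clip_of_mem {r : ℝ} (h : r ∈ Icc (0 : ℝ) 1) : clip r = r := by
  rw [clip, min_eq_right h.2, max_eq_right h.1]

theorem clip_mem (r : ℝ) : clip r ∈ Icc (0 : ℝ) 1 :=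
  ⟨le_max_left _ _, max_le zero_le_one (min_le_left _ _)⟩

theorem half_of_le {r : ℝ} (h : 1 / 2 ≤ |r|) : half r = 1 / 2 ∨ half r = -(1 / 2) := by
  rcases le_abs.1 h with h | h
  · left; rw [half, min_eq_left h, max_eq_right (by norm_num)]
  · right; exact max_eq_left ((min_le_right _ _).trans (by linarith))

theorem half_neg (r : ℝ) : half (-r) = -half r := by
  rw [half, half]
  rcases le_total r (-(1 / 2)) with h | h <;> rcases le_total r (1 / 2) with h' | h' <;>
    simp only [min_def, max_def] <;> split_ifs <;> linarith

theorem exists_half_of_le_norm {w : Fin k → ℝ} (h : 1 / 2 ≤ ‖w‖) :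
    ∃ i, half (w i) = 1 / 2 ∨ half (w i) = -(1 / 2) := by
  by_contra! hw
  refine h.not_gt ((pi_norm_lt_iff (by norm_num)).2 fun i => ?_)
  by_contra! hi
  rcases half_of_le hi with hi | hi
  exacts [(hw i).1 hi, (hw i).2 hi]

/-- The map from `ℝ^k` to the grid that wraps the cube `‖w‖ ≤ 1/2` around the cube with center
`c + 1/2` at height `j`, and contracts the remainder to the origin. -/
noncomputable def cell (c : Fin k → ℤ) (j : ℤ) (w : Fin k → ℝ) : (Fin k → ℝ) × ℝ :=
  ((1 - clip (‖w‖ - 1)) • fun i => (c i : ℝ) + 1 / 2 + half (w i), (1 - clip (2 * ‖w‖ - 1)) * j)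

theorem continuous_cell (c : Fin k → ℤ) (j : ℤ) : Continuous (cell c j) := by
  unfold cell; fun_prop

theorem cell_eq_zero (c : Fin k → ℤ) (j : ℤ) {w : Fin k → ℝ} (h : 2 ≤ ‖w‖) : cell c j w = 0 := by
  rw [cell, clip_of_one_le (by linarith), clip_of_one_le (by linarith)]
  simp

theorem cell_mem (c : Fin k → ℤ) (j : ℤ) (w : Fin k → ℝ) : cell c j w ∈ gridSet k := by
  rcases le_total ‖w‖ (1 / 2) with h | h
  · right
    exact ⟨j, by rw [cell, clip_of_nonpos (r := 2 * ‖w‖ - 1) (by linarith)]; simp⟩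
  rcases le_total ‖w‖ 1 with h' | h'
  · left
    obtain ⟨i, hi⟩ := exists_half_of_le_norm h
    refine ⟨i, ?_⟩
    rw [cell, clip_of_nonpos (r := ‖w‖ - 1) (by linarith)]
    rcases hi with hi | hi
    · exact ⟨c i + 1, by simp [hi]; ring⟩
    · exact ⟨c i, by simp [hi]⟩
  · right
    exact ⟨0, by rw [cell, clip_of_one_le (r := 2 * ‖w‖ - 1) (by linarith)]; simp⟩

/-- The boundary of the unit cube. -/
def faces (k : ℕ) : Set (Fin k → ℝ) := {x | x ∈ Icc 0 1 ∧ ∃ i, x i = 0 ∨ x i = 1}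

theorem isCompact_faces : IsCompact (faces k) := by
  refine isCompact_Icc.inter_right (t := {x : Fin k → ℝ | ∃ i, x i = 0 ∨ x i = 1}) ?_
  simp only [ofPred_exists]
  refine isClosed_iUnion_of_finite fun i => ?_
  exact (isClosed_eq (continuous_apply i) continuous_const).union
    (isClosed_eq (continuous_apply i) continuous_const)

/-- The projection of a real vector space onto the unit cube. -/
def proj (x : Fin k → ℝ) : Fin k → ℝ := fun i => clip (x i)

@[fun_prop]
theorem continuous_proj : Continuous (proj : (Fin k → ℝ) → Fin k → ℝ) := by
  unfold proj; fun_prop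

theorem proj_of_mem {x : Fin k → ℝ} (h : x ∈ Icc (0 : Fin k → ℝ) 1) : proj x = x :=
  funext fun i => clip_of_mem ⟨h.1 i, h.2 i⟩

theorem proj_mem (x : Fin k → ℝ) : proj x ∈ Icc (0 : Fin k → ℝ) 1 :=
  ⟨fun i => (clip_mem (x i)).1, fun i => (clip_mem (x i)).2⟩

theorem proj_mem_faces {x : Fin k → ℝ} {i : Fin k} (h : x i ≤ 0 ∨ 1 ≤ x i) : proj x ∈ faces k :=
  ⟨proj_mem x, i, h.imp clip_of_nonpos clip_of_one_le⟩

theorem clip_one_sub (r : ℝ) : clip (1 - r) = 1 - clip r := by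
  rw [clip, clip]
  rcases le_total r 0 with h | h <;> rcases le_total r 1 with h' | h' <;>
    simp only [min_def, max_def] <;> split_ifs <;> linarith

theorem proj_reflect (x : Fin k → ℝ) (i : Fin k) :
    proj (Function.update x i (1 - x i)) = Function.update (proj x) i (1 - proj x i) := by
  ext j
  rcases eq_or_ne j i with rfl | hj
  · simp [proj, clip_one_sub]
  · simp [proj, hj]

theorem isLoop_cell (c : Fin k → ℤ) (j : ℤ) {W : (Fin k → ℝ) → Fin k → ℝ} (hW : Continuous W)
    (h : ∀ x ∈ faces k, 2 ≤ ‖W x‖) : IsLoop fun x => cell c j (W (proj x)) :=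
  ⟨(continuous_cell c j).comp (hW.comp continuous_proj), fun _ => cell_mem c j _,
    fun _ _ hx => cell_eq_zero c j (h _ (proj_mem_faces hx))⟩

theorem half_le_norm_sub {x : Fin k → ℝ} (hx : x ∈ faces k) :
    1 / 2 ≤ ‖x - fun _ => (1 / 2 : ℝ)‖ := by
  obtain ⟨-, i, hi⟩ := hx
  refine le_trans ?_ (norm_le_pi_norm _ i)
  rcases hi with hi | hi
  · norm_num [hi]
  · norm_num [hi]

theorem isLoop_generator (c : Fin k → ℤ) (j : ℤ) :
    IsLoop fun x => cell c j ((4 : ℝ) • (proj x - fun _ => (1 / 2 : ℝ))) :=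
  isLoop_cell c j (W := fun x => (4 : ℝ) • (x - fun _ => (1 / 2 : ℝ))) (by fun_prop) fun x hx => by
    rw [norm_smul, Real.norm_of_nonneg (by norm_num)]
    linarith [half_le_norm_sub hx]

variable {d : ℕ} {H : Subgroup (HomotopyGroup (Fin (d + 1)) (gridSet (d + 1)) (origin (d + 1)))}
  {c : Fin (d + 1) → ℤ} {j : ℤ} {W : (Fin (d + 1) → ℝ) → Fin (d + 1) → ℝ}

theorem cls_cell_eq {W : ℝ → (Fin k → ℝ) → Fin k → ℝ} {c : Fin k → ℤ}
    (hW : Continuous fun p : ℝ × (Fin k → ℝ) => W p.1 p.2)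
    (h : ∀ s ∈ Icc (0 : ℝ) 1, ∀ x ∈ faces k, 2 ≤ ‖W s x‖)
    (h0 : IsLoop fun x => cell c j (W 0 (proj x))) (h1 : IsLoop fun x => cell c j (W 1 (proj x))) :
    h0.cls = h1.cls :=
  h0.cls_eq h1 (fun s x => cell c j (W s (proj x)))
    ((continuous_cell c j).comp (hW.comp (by fun_prop : Continuous fun p : ℝ × (Fin k → ℝ) =>
      (p.1, proj p.2)))) (fun _ _ _ => cell_mem c j _)
    (fun s hs _ _ hx => cell_eq_zero c j (h s hs _ (proj_mem_faces hx))) (fun _ => rfl)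
    fun _ => rfl

/-- All sufficiently large multiples of `W` define elements of the subgroup `H`. -/
def Eventually (H : Subgroup (HomotopyGroup (Fin (d + 1)) (gridSet (d + 1)) (origin (d + 1))))
    (c : Fin (d + 1) → ℤ) (j : ℤ) (W : (Fin (d + 1) → ℝ) → Fin (d + 1) → ℝ) : Prop :=
  ∃ M₀ : ℝ, ∀ M ≥ M₀, ∀ hl : IsLoop fun x => cell c j (M • W (proj x)), hl.cls ∈ H

theorem Eventually.of_path {W : ℝ → (Fin (d + 1) → ℝ) → Fin (d + 1) → ℝ}
    (hW : Continuous fun p : ℝ × (Fin (d + 1) → ℝ) => W p.1 p.2)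
    (h : ∀ s ∈ Icc (0 : ℝ) 1, ∀ x ∈ faces (d + 1), W s x ≠ 0) (h1 : Eventually H c j (W 1)) :
    Eventually H c j (W 0) := by
  obtain ⟨M₀, hM₀⟩ := h1
  obtain ⟨m, hm, hmW⟩ : ∃ m > 0, ∀ s ∈ Icc (0 : ℝ) 1, ∀ x ∈ faces (d + 1), m ≤ ‖W s x‖ := by
    have hne : (Icc (0 : ℝ) 1 ×ˢ faces (d + 1)).Nonempty :=
      ⟨(0, 0), by simp, by simp, 0, .inl rfl⟩
    obtain ⟨p, hp, hmin⟩ := (isCompact_Icc.prod isCompact_faces).exists_isMinOn hne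
      (f := fun p => ‖W p.1 p.2‖) hW.norm.continuousOn
    exact ⟨‖W p.1 p.2‖, norm_pos_iff.2 (h _ hp.1 _ hp.2), fun s hs x hx =>
      isMinOn_iff.1 hmin (s, x) ⟨hs, hx⟩⟩
  refine ⟨max M₀ (2 / m), fun M hM hl => ?_⟩
  have hM' : 2 / m ≤ M := (le_max_right _ _).trans hM
  have hMpos : 0 < M := (by positivity : 0 < 2 / m).trans_le hM'
  have hnorm : ∀ s ∈ Icc (0 : ℝ) 1, ∀ x ∈ faces (d + 1), 2 ≤ ‖M • W s x‖ := fun s hs x hx => by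
    rw [norm_smul, Real.norm_of_nonneg hMpos.le]
    rw [div_le_iff₀ hm] at hM'
    exact hM'.trans (mul_le_mul_of_nonneg_left (hmW s hs x hx) hMpos.le)
  have hl1 : IsLoop fun x => cell c j (M • W 1 (proj x)) :=
    isLoop_cell c j (W := fun x => M • W 1 x)
      ((hW.comp (by fun_prop : Continuous fun x : Fin (d + 1) → ℝ => ((1 : ℝ), x))).const_smul M)
      (hnorm 1 (by simp))
  rw [cls_cell_eq (W := fun s x => M • W s x) (hW.const_smul M) hnorm hl hl1]
  exact hM₀ M ((le_max_left _ _).trans hM) hl1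

theorem Eventually.cls_mem (hE : Eventually H c j W) (hW : Continuous W) {Λ : ℝ} (hΛ : 0 ≤ Λ)
    (h : ∀ x ∈ faces (d + 1), 2 ≤ ‖Λ • W x‖) (hl : IsLoop fun x => cell c j (Λ • W (proj x))) :
    hl.cls ∈ H := by
  obtain ⟨M₀, hM₀⟩ := hE
  let W' : ℝ → (Fin (d + 1) → ℝ) → Fin (d + 1) → ℝ := fun s x =>
    ((1 - s) * Λ + s * max M₀ Λ) • W x
  have hW' : Continuous fun p : ℝ × (Fin (d + 1) → ℝ) => W' p.1 p.2 :=
    (by fun_prop : Continuous fun p : ℝ × (Fin (d + 1) → ℝ) =>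
      (1 - p.1) * Λ + p.1 * max M₀ Λ).smul (hW.comp continuous_snd)
  have hnorm : ∀ s ∈ Icc (0 : ℝ) 1, ∀ x ∈ faces (d + 1), 2 ≤ ‖W' s x‖ := fun s hs x hx => by
    have hle : Λ ≤ (1 - s) * Λ + s * max M₀ Λ := by nlinarith [hs.1, le_max_right M₀ Λ]
    refine (h x hx).trans ?_
    rw [norm_smul, norm_smul, Real.norm_of_nonneg hΛ, Real.norm_of_nonneg (hΛ.trans hle)]
    exact mul_le_mul_of_nonneg_right hle (norm_nonneg _)
  have e0 : ∀ x, W' 0 x = Λ • W x := fun x => by simp [W']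
  have e1 : ∀ x, W' 1 x = max M₀ Λ • W x := fun x => by simp [W']
  have hl0 : IsLoop fun x => cell c j (W' 0 (proj x)) := by simpa only [e0] using hl
  have hl1 : IsLoop fun x => cell c j (W' 1 (proj x)) :=
    isLoop_cell c j (hW'.comp (by fun_prop : Continuous fun x : Fin (d + 1) → ℝ => ((1 : ℝ), x)))
      (hnorm 1 (by simp))
  rw [hl.cls_congr hl0 fun x => by rw [e0], cls_cell_eq hW' hnorm hl0 hl1]
  have hl1' : IsLoop fun x => cell c j (max M₀ Λ • W (proj x)) := by simpa only [e1] using hl1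
  rw [hl1.cls_congr hl1' fun x => by rw [e1]]
  exact hM₀ _ (le_max_left _ _) hl1'

theorem Eventually.comp_reflect (hE : Eventually H c j W) (i : Fin (d + 1)) :
    Eventually H c j fun x => W (Function.update x i (1 - x i)) := by
  obtain ⟨M₀, hM₀⟩ := hE
  refine ⟨M₀, fun M hM hl => ?_⟩
  have hl' : IsLoop fun x => cell c j (M • W (proj x)) := by
    have := hl.comp_reflect i
    simpa [← proj_reflect] using this
  rw [hl.cls_congr (hl'.comp_reflect i) fun x => by rw [proj_reflect], hl'.cls_comp_reflect]
  exact H.inv_mem (hM₀ M hM hl')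

theorem eventually_id (hH : (isLoop_generator c j).cls ∈ H) :
    Eventually H c j fun x => x - fun _ => (1 / 2 : ℝ) := by
  refine ⟨4, fun M hM hl => ?_⟩
  let W' : ℝ → (Fin (d + 1) → ℝ) → Fin (d + 1) → ℝ := fun s x =>
    ((1 - s) * M + s * 4) • (x - fun _ => (1 / 2 : ℝ))
  have hW' : Continuous fun p : ℝ × (Fin (d + 1) → ℝ) => W' p.1 p.2 := by
    simp only [W']
    fun_prop
  have hnorm : ∀ s ∈ Icc (0 : ℝ) 1, ∀ x ∈ faces (d + 1), 2 ≤ ‖W' s x‖ := fun s hs x hx => by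
    have hle : 4 ≤ (1 - s) * M + s * 4 := by nlinarith [hs.1, hs.2]
    rw [norm_smul, Real.norm_of_nonneg (by linarith)]
    nlinarith [half_le_norm_sub hx]
  have e0 : ∀ x, W' 0 x = M • (x - fun _ => (1 / 2 : ℝ)) := fun x => by simp [W']
  have e1 : ∀ x, W' 1 x = (4 : ℝ) • (x - fun _ => (1 / 2 : ℝ)) := fun x => by simp [W']
  have hl0 : IsLoop fun x => cell c j (W' 0 (proj x)) := by simpa only [e0] using hl
  have hl1 : IsLoop fun x => cell c j (W' 1 (proj x)) := by
    simpa only [e1] using isLoop_generator c j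
  rw [hl.cls_congr hl0 fun x => by rw [e0], cls_cell_eq hW' hnorm hl0 hl1,
    hl1.cls_congr (isLoop_generator c j) fun x => by rw [e1]]
  exact hH

theorem Eventually.congr {W' : (Fin (d + 1) → ℝ) → Fin (d + 1) → ℝ} (hE : Eventually H c j W)
    (h : ∀ x, W' x = W x) : Eventually H c j W' := by
  obtain rfl : W' = W := funext h
  exact hE

theorem eventually_sign (hH : (isLoop_generator c j).cls ∈ H) (S : Finset (Fin (d + 1))) :
    Eventually H c j fun x i => (if i ∈ S then -1 else 1) * (x i - 1 / 2) := by
  induction S using Finset.induction_on with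
  | empty => exact (eventually_id hH).congr fun x => by ext; simp
  | insert a S ha ih =>
    refine (ih.comp_reflect a).congr fun x => ?_
    ext i
    rcases eq_or_ne i a with rfl | hi
    · simp [ha]; ring
    · simp [hi]

/-- An invertible real matrix can be deformed to an invertible diagonal matrix. -/
theorem exists_path_diagonal {ι : Type*} [Fintype ι] [DecidableEq ι] (A : Matrix ι ι ℝ)
    (hA : A.det ≠ 0) : ∃ (v : ι → ℝ) (γ : ℝ → Matrix ι ι ℝ), Continuous γ ∧ γ 0 = A ∧
      γ 1 = Matrix.diagonal v ∧ ∀ s, (γ s).det ≠ 0 := by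
  refine Matrix.diagonal_transvection_induction_of_det_ne_zero (fun A => ∃ (v : ι → ℝ)
    (γ : ℝ → Matrix ι ι ℝ), Continuous γ ∧ γ 0 = A ∧ γ 1 = Matrix.diagonal v ∧
      ∀ s, (γ s).det ≠ 0) A hA ?_ ?_ ?_
  · exact fun v hv => ⟨v, fun _ => Matrix.diagonal v, continuous_const, rfl, rfl, fun _ => hv⟩
  · intro t
    refine ⟨1, fun s => Matrix.transvection t.i t.j ((1 - s) * t.c), ?_, ?_, ?_, fun s => ?_⟩
    · refine continuous_const.add (continuous_matrix fun a b => ?_)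
      simp only [Matrix.single_apply]
      split_ifs <;> fun_prop
    · simp [Matrix.TransvectionStruct.toMatrix]
    · simp
    · rw [Matrix.det_transvection_of_ne _ _ t.hij]
      exact one_ne_zero
  · rintro B C - - ⟨v, γ, hγ, h0, h1, hdet⟩ ⟨v', γ', hγ', h0', h1', hdet'⟩
    refine ⟨fun i => v i * v' i, fun s => γ s * γ' s, hγ.matrix_mul hγ', ?_, ?_, fun s => ?_⟩
    · simp only [h0, h0']
    · simp only [h1, h1', Matrix.diagonal_mul_diagonal]
    · rw [Matrix.det_mul]
      exact mul_ne_zero (hdet s) (hdet' s)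

theorem eventually_matrix (hH : (isLoop_generator c j).cls ∈ H)
    (A : Matrix (Fin (d + 1)) (Fin (d + 1)) ℝ) (hA : A.det ≠ 0) :
    Eventually H c j fun x => A.mulVec (x - fun _ => (1 / 2 : ℝ)) := by
  obtain ⟨v, γ, hγ, h0, h1, hdet⟩ := exists_path_diagonal A hA
  have hx : ∀ x ∈ faces (d + 1), (x - fun _ => (1 / 2 : ℝ)) ≠ 0 := fun x hx h => by
    have := half_le_norm_sub hx
    rw [h, norm_zero] at this
    norm_num at this
  have hv (i : Fin (d + 1)) : v i ≠ 0 := by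
    have := hdet 1
    rw [h1, Matrix.det_diagonal] at this
    exact (Finset.prod_ne_zero_iff.1 this) i (Finset.mem_univ i)
  classical
  obtain ⟨ε, hε⟩ : ∃ ε : Fin (d + 1) → ℝ, ∀ i,
    ε i = if i ∈ Finset.univ.filter (fun i => v i < 0) then -1 else 1 := ⟨_, fun _ => rfl⟩
  have key : Eventually H c j fun x i => v i * (x i - 1 / 2) := by
    have := Eventually.of_path (H := H) (c := c) (j := j)
      (W := fun s x i => ((1 - s) * v i + s * ε i) * (x i - 1 / 2)) (by fun_prop)
      (fun s hs x hxf h => hx x hxf ?_) ?_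
    · exact this.congr fun x => by ext; simp
    · ext i
      have hi := congrFun h i
      refine (mul_eq_zero.1 hi).resolve_left fun h' => ?_
      rw [hε] at h'
      simp only [Finset.mem_filter, Finset.mem_univ, true_and] at h'
      split_ifs at h' with hneg
      · nlinarith [hs.1, hs.2, mul_nonneg (sub_nonneg.2 hs.2) (neg_nonneg.2 hneg.le),
          mul_nonneg hs.1 (neg_nonneg.2 hneg.le)]
      · have := (not_lt.1 hneg).lt_of_ne' (hv i)
        nlinarith [hs.1, hs.2, mul_nonneg (sub_nonneg.2 hs.2) this.le, mul_nonneg hs.1 this.le]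
    · exact (eventually_sign hH (Finset.univ.filter fun i => v i < 0)).congr fun x => by
        ext i; simp [hε]
  have := Eventually.of_path (H := H) (c := c) (j := j)
    (W := fun s x => (γ s).mulVec (x - fun _ => (1 / 2 : ℝ)))
    ((hγ.comp continuous_fst).matrix_mulVec (by fun_prop))
    (fun s _ x hxf h => hx x hxf (Matrix.eq_zero_of_mulVec_eq_zero (hdet s) h))
    (key.congr fun x => by ext i; simp [h1, Matrix.mulVec_diagonal])
  exact this.congr fun x => by rw [h0]

end Grid

namespace Grid

open Set

variable {k : ℕ}

theorem half_of_abs_le {r : ℝ} (h : |r| ≤ 1 / 2) : half r = r := by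
  rw [half, min_eq_right (abs_le.1 h).2, max_eq_right (abs_le.1 h).1]

/-- The map of the real line that stretches every interval between integers about its midpoint by
the factor `max 1 l`, truncated at the end points. -/
noncomputable def stretch (l a : ℝ) : ℝ := ⌊a⌋ + 1 / 2 + half (max 1 l * (Int.fract a - 1 / 2))

theorem continuous_stretch : Continuous fun p : ℝ × ℝ => stretch p.1 p.2 := by
  have key : Continuous fun p : ℝ × ℝ =>
      half (max 1 p.1 * (Int.fract p.2 - 1 / 2)) - (Int.fract p.2 - 1 / 2) := by
    refine ContinuousOn.comp_fract'
      (f := fun l v : ℝ => half (max 1 l * (v - 1 / 2)) - (v - 1 / 2))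
      (Continuous.continuousOn ?_) fun l => ?_
    · simp only [Function.uncurry_def]
      fun_prop
    · have : max 1 l * (0 - 1 / 2) = -(max 1 l * (1 - 1 / 2)) := by ring
      rw [this, half_neg]
      have h1 : 1 / 2 ≤ max 1 l * (1 - 1 / 2) := by linarith [le_max_left 1 l]
      have : half (max 1 l * (1 - 1 / 2)) = 1 / 2 := by
        rw [half, min_eq_left h1, max_eq_right (by norm_num)]
      rw [this]
      norm_num
  refine (key.add continuous_snd).congr fun p => ?_
  rw [stretch, Pi.add_apply]
  linarith [Int.floor_add_fract p.2]

@[fun_prop]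
theorem _root_.Continuous.stretch {α : Type*} [TopologicalSpace α] {f g : α → ℝ}
    (hf : Continuous f) (hg : Continuous g) : Continuous fun x => stretch (f x) (g x) :=
  continuous_stretch.comp (hf.prodMk hg)

theorem stretch_one (a : ℝ) : stretch 1 a = a := by
  have h0 := Int.fract_nonneg a
  have h1 := Int.fract_lt_one a
  rw [stretch, max_self, one_mul, half_of_abs_le (abs_le.2 ⟨by linarith, by linarith⟩)]
  linarith [Int.floor_add_fract a]

theorem exists_stretch_eq {l a : ℝ} (h : 1 / 2 ≤ max 1 l * |Int.fract a - 1 / 2|) :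
    ∃ z : ℤ, stretch l a = z := by
  have : 1 / 2 ≤ |max 1 l * (Int.fract a - 1 / 2)| := by
    rwa [abs_mul, abs_of_pos (zero_lt_one.trans_le (le_max_left 1 l))]
  rw [stretch]
  rcases half_of_le this with h | h
  · exact ⟨⌊a⌋ + 1, by rw [h]; push_cast; ring⟩
  · exact ⟨⌊a⌋, by rw [h]; ring⟩

theorem stretch_intCast (l : ℝ) (z : ℤ) : stretch l z = z := by
  rw [stretch, Int.fract_intCast, Int.floor_intCast, zero_sub, mul_neg, half_neg, half,
    min_eq_left (by linarith [le_max_left 1 l]), max_eq_right (by norm_num)]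
  ring

theorem stretch_of_abs_lt {l a : ℝ} {c : ℤ} (hl : 1 ≤ l) (h : |a - (c + 1 / 2)| < 1 / 2) :
    stretch l a = c + 1 / 2 + half (l * (a - (c + 1 / 2))) := by
  rw [abs_lt] at h
  have hc : ⌊a⌋ = c := Int.floor_eq_iff.2 ⟨by linarith, by linarith⟩
  rw [stretch, max_eq_right hl, Int.fract, hc, sub_sub]

/-- The sup-distance of `y` to the closest center of a unit cube with integral vertices. -/
noncomputable def centerDist (y : Fin k → ℝ) : ℝ := ‖fun i => |Int.fract (y i) - 1 / 2|‖

theorem abs_le_centerDist (y : Fin k → ℝ) (i : Fin k) :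
    |Int.fract (y i) - 1 / 2| ≤ centerDist y := by
  have := norm_le_pi_norm (fun i => |Int.fract (y i) - 1 / 2|) i
  rwa [Real.norm_of_nonneg (abs_nonneg _)] at this

theorem exists_le_abs {y : Fin k → ℝ} {a : ℝ} (ha : 0 < a) (h : a ≤ centerDist y) :
    ∃ i, a ≤ |Int.fract (y i) - 1 / 2| := by
  by_contra! hy
  refine h.not_gt ((pi_norm_lt_iff ha).2 fun i => ?_)
  rw [Real.norm_of_nonneg (abs_nonneg _)]
  exact hy i

@[fun_prop]
theorem continuous_centerDist : Continuous (centerDist : (Fin k → ℝ) → ℝ) := by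
  refine (continuous_pi fun i => ?_).norm
  exact (ContinuousOn.comp_fract'' (f := fun v : ℝ => |v - 1 / 2|) (by fun_prop)
    (by norm_num [abs_of_pos])).comp (continuous_apply i)

theorem centerDist_of_norm_lt {y : Fin k → ℝ} {c : Fin k → ℤ}
    (h : ‖y - fun i => (c i : ℝ) + 1 / 2‖ < 1 / 2) :
    centerDist y = ‖y - fun i => (c i : ℝ) + 1 / 2‖ := by
  have : (fun i => |Int.fract (y i) - 1 / 2|) = fun i => ‖(y - fun i => (c i : ℝ) + 1 / 2) i‖ := by
    ext i
    have hi := abs_lt.1 ((norm_le_pi_norm _ i).trans_lt h)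
    simp only [Pi.sub_apply] at hi
    have hc : ⌊y i⌋ = c i := Int.floor_eq_iff.2 ⟨by linarith, by linarith⟩
    simp [Int.fract, hc, sub_sub]
  rw [centerDist, this]
  simp only [Pi.norm_def, nnnorm_norm]

/-- A deformation of the grid that concentrates loops in small neighbourhoods of the centers of
the horizontal unit cubes. -/
noncomputable def deform (L s : ℝ) (p : (Fin k → ℝ) × ℝ) : (Fin k → ℝ) × ℝ :=
  ((1 - clip (3 * s - 2) * max (clip (L * centerDist p.1 - 1)) (clip (1 - |p.2|))) •
      fun i => stretch (1 + (L - 1) * clip (3 * s)) (p.1 i),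
    (1 - clip (3 * s - 1) * clip (2 * (L * centerDist p.1) - 1)) * p.2)

theorem continuous_deform (L : ℝ) :
    Continuous fun q : ℝ × ((Fin k → ℝ) × ℝ) => deform L q.1 q.2 := by
  unfold deform; fun_prop

theorem deform_zero (L : ℝ) (p : (Fin k → ℝ) × ℝ) : deform L 0 p = p := by
  rw [deform, clip_of_nonpos (r := 3 * 0 - 2) (by norm_num),
    clip_of_nonpos (r := 3 * 0 - 1) (by norm_num), clip_of_nonpos (r := 3 * 0) (by norm_num)]
  simp [stretch_one]

theorem deform_mem {L : ℝ} (hL : 8 ≤ L) (s : ℝ) {p : (Fin k → ℝ) × ℝ} (hp : p ∈ gridSet k) :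
    deform L s p ∈ gridSet k := by
  rcases hp with ⟨i, z, hz⟩ | ⟨z, hz⟩
  · have hr : 1 / 2 ≤ centerDist p.1 := by
      simpa [hz, abs_of_pos] using abs_le_centerDist p.1 i
    rcases le_total s (2 / 3) with hs | hs
    · refine .inl ⟨i, z, ?_⟩
      rw [deform, clip_of_nonpos (r := 3 * s - 2) (by linarith)]
      simp [hz, stretch_intCast]
    · refine .inr ⟨0, ?_⟩
      rw [deform, clip_of_one_le (r := 3 * s - 1) (by linarith),
        clip_of_one_le (r := 2 * (L * centerDist p.1) - 1) (by nlinarith)]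
      simp
  rcases le_total (L * centerDist p.1) (1 / 2) with hr | hr
  · refine .inr ⟨z, ?_⟩
    rw [deform, clip_of_nonpos (r := 2 * (L * centerDist p.1) - 1) (by linarith)]
    simpa using hz
  rcases le_total s (1 / 3) with hs | hs
  · refine .inr ⟨z, ?_⟩
    rw [deform, clip_of_nonpos (r := 3 * s - 1) (by linarith)]
    simpa using hz
  by_cases hz0 : z = 0
  · exact .inr ⟨0, by simp [deform, hz, hz0]⟩
  rcases le_total s (2 / 3) with hs' | hs'
  swap
  · rcases le_total 1 (L * centerDist p.1) with hr' | hr'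
    · refine .inr ⟨0, ?_⟩
      rw [deform, clip_of_one_le (r := 3 * s - 1) (by linarith),
        clip_of_one_le (r := 2 * (L * centerDist p.1) - 1) (by linarith)]
      simp
    · obtain ⟨i, hi⟩ := exists_le_abs (a := 1 / 2 / L) (by positivity)
        ((div_le_iff₀' (by linarith)).2 hr)
      obtain ⟨w, hw⟩ := exists_stretch_eq (l := L) (a := p.1 i)
        (by rwa [max_eq_right (by linarith), ← div_le_iff₀' (by linarith)])
      refine .inl ⟨i, w, ?_⟩
      have h1 : (1 : ℝ) ≤ |p.2| := by
        rw [hz, ← Int.cast_abs]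
        exact_mod_cast Int.one_le_abs hz0
      rw [deform, clip_of_nonpos (r := L * centerDist p.1 - 1) (by linarith),
        clip_of_nonpos (r := 1 - |p.2|) (by linarith), clip_of_one_le (r := 3 * s) (by linarith)]
      simpa using hw
  · obtain ⟨i, hi⟩ := exists_le_abs (a := 1 / 2 / L) (by positivity)
        ((div_le_iff₀' (by linarith)).2 hr)
    obtain ⟨w, hw⟩ := exists_stretch_eq (l := L) (a := p.1 i)
        (by rwa [max_eq_right (by linarith), ← div_le_iff₀' (by linarith)])
    refine .inl ⟨i, w, ?_⟩
    rw [deform, clip_of_nonpos (r := 3 * s - 2) (by linarith),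
      clip_of_one_le (r := 3 * s) (by linarith)]
    simpa using hw

theorem deform_apply_zero (L s : ℝ) : deform L s (0 : (Fin k → ℝ) × ℝ) = 0 := by
  have := stretch_intCast (1 + (L - 1) * clip (3 * s)) 0
  rw [Int.cast_zero] at this
  ext <;> simp [deform, this]

/-- The final stage of the deformation of the grid. -/
noncomputable def collapse (L : ℝ) : (Fin k → ℝ) × ℝ → (Fin k → ℝ) × ℝ := deform L 1

theorem collapse_eq (L : ℝ) (p : (Fin k → ℝ) × ℝ) : collapse L p =
    ((1 - max (clip (L * centerDist p.1 - 1)) (clip (1 - |p.2|))) • fun i => stretch L (p.1 i),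
      (1 - clip (2 * (L * centerDist p.1) - 1)) * p.2) := by
  rw [collapse, deform, clip_of_one_le (r := 3 * 1 - 2) (by norm_num),
    clip_of_one_le (r := 3 * 1 - 1) (by norm_num), clip_of_one_le (r := 3 * 1) (by norm_num)]
  simp

@[fun_prop]
theorem continuous_collapse (L : ℝ) : Continuous (collapse L : (Fin k → ℝ) × ℝ → _) :=
  (continuous_deform L).comp (Continuous.prodMk_right 1)

theorem collapse_mem {L : ℝ} (hL : 8 ≤ L) {p : (Fin k → ℝ) × ℝ} (hp : p ∈ gridSet k) :
    collapse L p ∈ gridSet k := deform_mem hL 1 hp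

theorem collapse_of_le {L : ℝ} {p : (Fin k → ℝ) × ℝ} (h : 2 ≤ L * centerDist p.1) :
    collapse L p = 0 := by
  rw [collapse_eq, clip_of_one_le (r := L * centerDist p.1 - 1) (by linarith),
    clip_of_one_le (r := 2 * (L * centerDist p.1) - 1) (by linarith), max_eq_left (clip_mem _).2]
  simp

theorem collapse_zero_right (L : ℝ) (y : Fin k → ℝ) : collapse L (y, 0) = 0 := by
  rw [collapse_eq, clip_of_one_le (r := 1 - |((y, 0) : (Fin k → ℝ) × ℝ).2|) (by simp),
    max_eq_right (clip_mem _).2]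
  simp

theorem collapse_eq_cell {L : ℝ} (hL : 8 ≤ L) {y : Fin k → ℝ} {c : Fin k → ℤ} {j : ℤ} (hj : j ≠ 0)
    (h : ‖y - fun i => (c i : ℝ) + 1 / 2‖ < 1 / 2) :
    collapse L (y, (j : ℝ)) = cell c j (L • (y - fun i => (c i : ℝ) + 1 / 2)) := by
  have h1 : (1 : ℝ) ≤ |(j : ℝ)| := by
    rw [← Int.cast_abs]
    exact_mod_cast Int.one_le_abs hj
  rw [collapse_eq, cell, norm_smul, Real.norm_of_nonneg (by linarith : 0 ≤ L)]
  simp only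
  rw [centerDist_of_norm_lt h, clip_of_nonpos (r := 1 - |(j : ℝ)|) (by linarith),
    max_eq_left (clip_mem _).1]
  congr 2
  ext i
  rw [stretch_of_abs_lt (by linarith) ((norm_le_pi_norm _ i).trans_lt h)]
  simp

theorem IsLoop.collapse {f : (Fin k → ℝ) → (Fin k → ℝ) × ℝ} (hf : IsLoop f) {L : ℝ} (hL : 8 ≤ L) :
    IsLoop fun x => collapse L (f x) :=
  ⟨(continuous_collapse L).comp hf.continuous, fun x => collapse_mem hL (hf.mem x),
    fun x i hx => by rw [hf.zero x i hx]; exact deform_apply_zero L 1⟩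

theorem IsLoop.cls_collapse {f : (Fin k → ℝ) → (Fin k → ℝ) × ℝ} (hf : IsLoop f) {L : ℝ}
    (hL : 8 ≤ L) : (hf.collapse hL).cls = hf.cls :=
  (hf.cls_eq (hf.collapse hL) (fun s x => deform L s (f x))
    ((continuous_deform L).comp (by
      have := hf.continuous
      fun_prop : Continuous fun p : ℝ × (Fin k → ℝ) => (p.1, f p.2)))
    (fun s _ x => deform_mem hL s (hf.mem x))
    (fun s _ x i hx => by rw [hf.zero x i hx, deform_apply_zero])
    (fun _ => deform_zero L _) fun _ => rfl).symm

end Grid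

namespace Grid

open Set

variable {d : ℕ} {H : Subgroup (HomotopyGroup (Fin (d + 1)) (gridSet (d + 1)) (origin (d + 1)))}
  {f : (Fin (d + 1) → ℝ) → (Fin (d + 1) → ℝ) × ℝ} {c : Fin (d + 1) → ℤ} {j : ℤ} {r : ℝ}

/-- A loop that vanishes outside finitely many separated small cubes lies in a subgroup as soon as
its restrictions to the individual cubes do. -/
theorem IsLoop.cls_mem_of_finset (hf : IsLoop f) (T : Finset (Fin (d + 1) → ℝ)) (hr : 0 < r)
    (hcube : ∀ p ∈ T, ∀ i, r ≤ p i ∧ p i ≤ 1 - r)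
    (hsep : ∀ p ∈ T, ∀ q ∈ T, ∀ i, p i < q i → p i + 2 * r ≤ q i)
    (hsupp : ∀ x, f x ≠ 0 → ∃ p ∈ T, dist x p < r)
    (hloc : ∀ p ∈ T, ∀ g (hg : IsLoop g), (∀ x, dist x p < r → g x = f x) →
      (∀ x, r ≤ dist x p → g x = 0) → hg.cls ∈ H) : hf.cls ∈ H := by
  induction hT : T.card using Nat.strong_induction_on generalizing f T with
  | _ N ih =>
    subst hT
    by_cases htriv : ∃ p ∈ T, ∃ q ∈ T, ∃ i, p i < q i
    · obtain ⟨p, hp, q, hq, i, hpq⟩ := htriv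
      have hcoord {x p' : Fin (d + 1) → ℝ} (h : dist x p' < r) : |x i - p' i| < r :=
        (dist_le_pi_dist x p' i).trans_lt h
      have ha : q i - r ∈ Icc (0 : ℝ) 1 :=
        ⟨by linarith [(hcube q hq i).1], by linarith [(hcube q hq i).2]⟩
      have hlow {x p' : Fin (d + 1) → ℝ} (hp' : p' ∈ T) (h : dist x p' < r) (h' : p' i < q i) :
          x i < q i - r := by
        have := abs_lt.1 (hcoord h)
        linarith [hsep p' hp' q hq i h']
      have hupp {x p' : Fin (d + 1) → ℝ} (h : dist x p' < r) (h' : q i ≤ p' i) :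
          q i - r < x i := by
        have := abs_lt.1 (hcoord h)
        linarith
      have hcut : ∀ x, x i = q i - r → f x = 0 := fun x hx => by
        by_contra hne
        obtain ⟨p', hp', hd⟩ := hsupp x hne
        rcases lt_or_ge (p' i) (q i) with h | h
        · exact (hlow hp' hd h).ne hx
        · exact (hupp hd h).ne' hx
      have hlt1 : (T.filter fun p' => q i ≤ p' i).card < T.card :=
        Finset.card_lt_card (Finset.filter_ssubset.2 ⟨p, hp, not_le.2 hpq⟩)
      have hlt2 : (T.filter fun p' => p' i < q i).card < T.card :=
        Finset.card_lt_card (Finset.filter_ssubset.2 ⟨q, hq, lt_irrefl _⟩)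
      rw [hf.cls_eq_mul ha hcut]
      refine H.mul_mem ?_ ?_
      · refine ih _ hlt1 (hf.cut_ge hcut) (T.filter fun p' => q i ≤ p' i)
          (fun p' hp' => hcube p' (Finset.mem_filter.1 hp').1)
          (fun p' hp' q' hq' => hsep p' (Finset.mem_filter.1 hp').1 q' (Finset.mem_filter.1 hq').1)
          (fun x hx => ?_) (fun p' hp' g hg h1 h2 => ?_) rfl
        · obtain ⟨hx1, hx2⟩ := ite_ne_right_iff.1 hx
          obtain ⟨p', hp', hd⟩ := hsupp x hx2
          refine ⟨p', Finset.mem_filter.2 ⟨hp', ?_⟩, hd⟩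
          by_contra! h
          exact (hlow hp' hd h).not_ge hx1
        · rw [Finset.mem_filter] at hp'
          exact hloc p' hp'.1 g hg
            (fun x hx => (h1 x hx).trans (if_pos (hupp hx hp'.2).le)) h2
      · refine ih _ hlt2 (hf.cut_le hcut) (T.filter fun p' => p' i < q i)
          (fun p' hp' => hcube p' (Finset.mem_filter.1 hp').1)
          (fun p' hp' q' hq' => hsep p' (Finset.mem_filter.1 hp').1 q' (Finset.mem_filter.1 hq').1)
          (fun x hx => ?_) (fun p' hp' g hg h1 h2 => ?_) rfl
        · obtain ⟨hx1, hx2⟩ := ite_ne_right_iff.1 hx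
          obtain ⟨p', hp', hd⟩ := hsupp x hx2
          refine ⟨p', Finset.mem_filter.2 ⟨hp', ?_⟩, hd⟩
          by_contra! h
          exact (hupp hd h).not_ge hx1
        · rw [Finset.mem_filter] at hp'
          exact hloc p' hp'.1 g hg
            (fun x hx => (h1 x hx).trans (if_pos (hlow hp'.1 hx hp'.2).le)) h2
    · push Not at htriv
      rcases T.eq_empty_or_nonempty with rfl | ⟨p, hp⟩
      · have : ∀ x, f x = 0 := fun x => by
          by_contra h
          simpa using hsupp x h
        rw [hf.cls_congr isLoop_zero this, cls_zero]
        exact H.one_mem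
      · refine hloc p hp f hf (fun _ _ => rfl) fun x hx => ?_
        by_contra h
        obtain ⟨q, hq, hd⟩ := hsupp x h
        obtain rfl : q = p := funext fun i => le_antisymm (htriv p hp q hq i) (htriv q hq p hp i)
        exact hx.not_gt hd

/-- A loop concentrated in a small cube, on which it is given by a map that is close to an
invertible affine map, is homotopic to a multiple of a generator. -/
theorem IsLoop.cls_mem_of_approx (hf : IsLoop f) (hH : (isLoop_generator c j).cls ∈ H)
    {g : (Fin (d + 1) → ℝ) → Fin (d + 1) → ℝ} (hg : Continuous g) {p : Fin (d + 1) → ℝ}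
    (hr : 0 < r) (hp : ∀ i, r ≤ p i ∧ p i ≤ 1 - r) {L m : ℝ} (hL : 0 ≤ L) (hm : 0 < m)
    (hLm : 2 ≤ L * (m / 2 * r)) (A : Matrix (Fin (d + 1)) (Fin (d + 1)) ℝ) (hA : A.det ≠ 0)
    (hAm : ∀ v, m * ‖v‖ ≤ ‖A.mulVec v‖)
    (happrox : ∀ x, dist x p ≤ r →
      ‖g x - (fun i => (c i : ℝ) + 1 / 2) - A.mulVec (x - p)‖ ≤ m / 2 * ‖x - p‖)
    (h1 : ∀ x, dist x p < r → f x = cell c j (L • (g x - fun i => (c i : ℝ) + 1 / 2)))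
    (h2 : ∀ x, r ≤ dist x p → f x = 0) : hf.cls ∈ H := by
  set C : Fin (d + 1) → ℝ := fun i => (c i : ℝ) + 1 / 2
  set e : Fin (d + 1) → ℝ := fun _ => 1 / 2
  let Z : (Fin (d + 1) → ℝ) → Fin (d + 1) → ℝ := fun x => p + (2 * r) • (x - e)
  have hZ : Continuous Z := by fun_prop
  let W : (Fin (d + 1) → ℝ) → Fin (d + 1) → ℝ := fun x => g (Z x) - C
  have hW : Continuous W := (hg.comp hZ).sub continuous_const
  have hZle : ∀ x ∈ Icc (0 : Fin (d + 1) → ℝ) 1, dist (Z x) p ≤ r := fun x hx => by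
    have : ‖x - e‖ ≤ 1 / 2 := (pi_norm_le_iff_of_nonneg (by norm_num)).2 fun i => by
      have h0 := hx.1 i
      have h1 := hx.2 i
      simp only [Pi.zero_apply, Pi.one_apply] at h0 h1
      simp only [Pi.sub_apply, e, Real.norm_eq_abs]
      exact abs_le.2 ⟨by linarith, by linarith⟩
    rw [dist_eq_norm, add_sub_cancel_left, norm_smul, Real.norm_of_nonneg (by linarith)]
    nlinarith
  have hZge : ∀ x ∈ faces (d + 1), r ≤ dist (Z x) p := fun x hx => by
    rw [dist_eq_norm, add_sub_cancel_left, norm_smul, Real.norm_of_nonneg (by linarith)]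
    nlinarith [half_le_norm_sub hx]
  have hlow : ∀ x, dist x p ≤ r → m / 2 * ‖x - p‖ ≤ ‖g x - C‖ := fun x hx => by
    have := norm_sub_norm_le (A.mulVec (x - p)) (A.mulVec (x - p) - (g x - C))
    rw [sub_sub_cancel, norm_sub_rev] at this
    linarith [happrox x hx, hAm (x - p)]
  have hnorm : ∀ x, dist x p = r → 2 ≤ ‖L • (g x - C)‖ := fun x hx => by
    rw [norm_smul, Real.norm_of_nonneg hL]
    refine hLm.trans (mul_le_mul_of_nonneg_left ?_ hL)
    rw [← hx, dist_eq_norm]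
    exact hlow x hx.le
  have hWfaces : ∀ x ∈ faces (d + 1), 2 ≤ ‖L • W x‖ := fun x hx =>
    hnorm _ ((hZle x hx.1).antisymm (hZge x hx))
  have hl : IsLoop fun x => cell c j (L • W (proj x)) :=
    isLoop_cell c j (W := fun x => L • W x) (hW.const_smul L) hWfaces
  have hball : ∀ x, dist x p ≤ r → f x = cell c j (L • (g x - C)) := fun x hx => by
    rcases hx.lt_or_eq with hx | hx
    · exact h1 x hx
    · rw [h2 x hx.ge, cell_eq_zero c j (hnorm x hx)]
  have hout : ∀ s ∈ Icc (0 : ℝ) 1, ∀ (x : Fin (d + 1) → ℝ) i, x i ≤ 0 ∨ 1 ≤ x i →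
      f ((1 - s) • x + s • Z x) = 0 := fun s hs x i hx => by
    refine h2 _ (le_trans ?_ (dist_le_pi_dist _ _ i))
    simp only [Real.dist_eq, Z, Pi.add_apply, Pi.smul_apply, Pi.sub_apply, smul_eq_mul, e]
    obtain ⟨hp0, hp1⟩ := hp i
    have hs0 := sub_nonneg.2 hs.2
    rcases hx with hx | hx
    · refine le_trans ?_ (neg_le_abs _)
      nlinarith [mul_nonneg hs0 (neg_nonneg.2 hx), mul_nonneg hs.1 (mul_nonneg hr.le
        (neg_nonneg.2 hx)), mul_nonneg hs0 (sub_nonneg.2 hp0)]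
    · refine le_trans ?_ (le_abs_self _)
      nlinarith [mul_nonneg hs0 (sub_nonneg.2 hx), mul_nonneg hs.1 (mul_nonneg hr.le
        (sub_nonneg.2 hx)), mul_nonneg hs0 (sub_nonneg.2 hp1)]
  have hcls : hf.cls = hl.cls := by
    refine hf.cls_eq hl (fun s x => f ((1 - s) • x + s • Z x)) (hf.continuous.comp (by fun_prop))
      (fun _ _ _ => hf.mem _) hout (fun x => by simp) fun x => ?_
    by_cases hx : x ∈ Icc (0 : Fin (d + 1) → ℝ) 1
    · rw [proj_of_mem hx]
      simpa using hball _ (hZle x hx)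
    · have : ∃ i, x i ≤ 0 ∨ 1 ≤ x i := by
        by_contra! h
        exact hx ⟨fun i => (h i).1.le, fun i => (h i).2.le⟩
      obtain ⟨i, hi⟩ := this
      rw [hout 1 (by simp) x i hi, cell_eq_zero c j (hWfaces _ (proj_mem_faces hi))]
  rw [hcls]
  refine Eventually.cls_mem ?_ hW hL hWfaces hl
  have hmat : Eventually H c j fun x => (2 * r) • A.mulVec (x - e) := by
    refine (eventually_matrix hH ((2 * r) • A) ?_).congr fun x => (Matrix.smul_mulVec _ _ _).symm
    rw [Matrix.det_smul]
    exact mul_ne_zero (pow_ne_zero _ (by linarith)) hA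
  have hpath := Eventually.of_path (H := H) (c := c) (j := j)
    (W := fun s x => (1 - s) • W x + s • (2 * r) • A.mulVec (x - e)) (by fun_prop)
    (fun s hs x hx h0 => ?_) (hmat.congr fun x => by simp)
  · exact hpath.congr fun x => by simp
  · have hx' : 0 < ‖Z x - p‖ := by
      rw [← dist_eq_norm]
      exact hr.trans_le (hZge x hx)
    have e1 : (2 * r) • A.mulVec (x - e) = A.mulVec (Z x - p) := by
      rw [add_sub_cancel_left, Matrix.mulVec_smul]
    have e2 : A.mulVec (Z x - p) = -((1 - s) • (W x - A.mulVec (Z x - p))) := by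
      rw [e1] at h0
      rw [eq_neg_iff_add_eq_zero, ← h0]
      module
    have := hAm (Z x - p)
    rw [e2, norm_neg, norm_smul, Real.norm_of_nonneg (sub_nonneg.2 hs.2)] at this
    have h3 := happrox (Z x) (hZle x hx.1)
    have h4 : (1 - s) * ‖W x - A.mulVec (Z x - p)‖ ≤ ‖W x - A.mulVec (Z x - p)‖ :=
      mul_le_of_le_one_left (norm_nonneg _) (by linarith [hs.1])
    nlinarith

end Grid

namespace Grid

open Set Filter MeasureTheory

variable {k d : ℕ}

/-- The center of a unit cube with integral vertices. -/
noncomputable def center (c : Fin k → ℤ) : Fin k → ℝ := fun i => (c i : ℝ) + 1 / 2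

theorem exists_regular_translate {g : (Fin k → ℝ) → Fin k → ℝ} (hg : Differentiable ℝ g) {ε : ℝ}
    (hε : 0 < ε) : ∃ v : Fin k → ℝ, ‖v‖ < ε ∧
      ∀ x (c : Fin k → ℤ), g x + v = center c → (fderiv ℝ g x).det ≠ 0 := by
  set Z : Set (Fin k → ℝ) := {x | (fderiv ℝ g x).det = 0}
  have hnull : volume (g '' Z) = 0 :=
    addHaar_image_eq_zero_of_det_fderivWithin_eq_zero volume
      (fun x _ => (hg x).hasFDerivAt.hasFDerivWithinAt) fun _ hx => hx
  have hbad : volume (⋃ c : Fin k → ℤ, (fun v => center c - v) ⁻¹' (g '' Z)) = 0 :=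
    measure_iUnion_null fun c =>
      (Measure.measurePreserving_sub_left volume (center c)).quasiMeasurePreserving.preimage_null hnull
  have hpos : 0 < volume (Metric.ball (0 : Fin k → ℝ) ε) := Metric.measure_ball_pos _ _ hε
  obtain ⟨v, hv, hv'⟩ : ∃ v ∈ Metric.ball (0 : Fin k → ℝ) ε,
      v ∉ ⋃ c : Fin k → ℤ, (fun v => center c - v) ⁻¹' (g '' Z) := by
    by_contra! h
    exact hpos.ne' (measure_mono_null h hbad)
  refine ⟨v, by simpa using hv, fun x c hx hdet => hv' (mem_iUnion.2 ⟨c, x, hdet, ?_⟩)⟩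
  exact (sub_eq_of_eq_add hx.symm).symm

theorem centerDist_eq_zero {y : Fin k → ℝ} (h : centerDist y = 0) :
    y = center fun i => ⌊y i⌋ := by
  ext i
  have := abs_nonpos_iff.1 ((abs_le_centerDist y i).trans h.le)
  rw [center]
  linarith [Int.floor_add_fract (y i)]

theorem eventually_forall_dist_le {α : Type*} [PseudoMetricSpace α] {p : α} {Q : α → Prop}
    (h : ∀ᶠ x in 𝓝 p, Q x) : ∀ᶠ r in 𝓝[>] (0 : ℝ), ∀ x, dist x p ≤ r → Q x := by
  obtain ⟨ε, hε, hQ⟩ := Metric.eventually_nhds_iff.1 h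
  filter_upwards [nhdsWithin_le_nhds (eventually_lt_nhds hε)] with r hr x hx
  exact hQ (hx.trans_lt hr)

/-- Near a regular point, a map is bounded below by its distance to the value at that point. -/
theorem exists_linear_approx {g : (Fin k → ℝ) → Fin k → ℝ} {p : Fin k → ℝ}
    (hg : DifferentiableAt ℝ g p) (hdet : (fderiv ℝ g p).det ≠ 0) :
    ∃ (A : Matrix (Fin k) (Fin k) ℝ) (m : ℝ), A.det ≠ 0 ∧ 0 < m ∧
      (∀ v, m * ‖v‖ ≤ ‖A.mulVec v‖) ∧
      ∀ᶠ x in 𝓝 p, ‖g x - g p - A.mulVec (x - p)‖ ≤ m / 2 * ‖x - p‖ := by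
  have hA (v : Fin k → ℝ) : (LinearMap.toMatrix' (fderiv ℝ g p).toLinearMap).mulVec v =
      fderiv ℝ g p v := LinearMap.toMatrix'_mulVec _ _
  let e := (fderiv ℝ g p).toContinuousLinearEquivOfDetNeZero hdet
  obtain ⟨K, hK, hanti⟩ : ∃ K : NNReal, 0 < K ∧ AntilipschitzWith K e := by
    refine ⟨‖(e.symm : (Fin k → ℝ) →L[ℝ] Fin k → ℝ)‖₊ + 1, by positivity, ?_⟩
    exact fun x y => (e.antilipschitz x y).trans (by gcongr; simp)
  have hK' : (0 : ℝ) < K := hK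
  refine ⟨LinearMap.toMatrix' (fderiv ℝ g p).toLinearMap, (K : ℝ)⁻¹, ?_, by positivity,
    fun v => ?_, ?_⟩
  · rw [LinearMap.det_toMatrix']
    exact hdet
  · rw [hA, inv_mul_le_iff₀ hK']
    simpa [e] using hanti.le_mul_dist v 0
  · simp only [hA]
    exact hg.hasFDerivAt.isLittleO.def (by positivity)


/-- The homotopy group of the grid is generated by the loops that wrap once around a horizontal
unit cube at a nonzero height. -/
theorem cls_mem_of_generators
    {H : Subgroup (HomotopyGroup (Fin (d + 1)) (gridSet (d + 1)) (origin (d + 1)))}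
    (hH : ∀ (c : Fin (d + 1) → ℤ) (j : ℤ), j ≠ 0 → (isLoop_generator c j).cls ∈ H)
    {f : (Fin (d + 1) → ℝ) → (Fin (d + 1) → ℝ) × ℝ} (hf : IsLoop f) : hf.cls ∈ H := by
  obtain ⟨g₀, hg₀, hgf₀, -⟩ := (continuous_fst.comp hf.continuous).exists_contDiff_approx 1
    (continuous_const (y := (1 / 16 : ℝ))) (fun _ => by norm_num)
  obtain ⟨v, hv, hreg⟩ := exists_regular_translate (hg₀.differentiable (by simp))
    (ε := 1 / 16) (by norm_num)
  obtain ⟨g, hg, hgf, hdet⟩ : ∃ g : (Fin (d + 1) → ℝ) → Fin (d + 1) → ℝ, Differentiable ℝ g ∧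
      (∀ x, ‖g x - (f x).1‖ ≤ 1 / 8) ∧
      ∀ x c, g x = center c → (fderiv ℝ g x).det ≠ 0 := by
    refine ⟨fun x => g₀ x + v, (hg₀.differentiable (by simp)).add_const v, fun x => ?_,
      fun x c hx => ?_⟩
    · have := hgf₀ x
      rw [dist_eq_norm] at this
      calc ‖g₀ x + v - (f x).1‖ = ‖(g₀ x - (f x).1) + v‖ := by congr 1; abel
        _ ≤ _ := (norm_add_le _ _).trans (by simp only [Function.comp_apply] at this; linarith)
    · rw [fderiv_add_const]
      exact hreg x c hx
  clear hreg hv v hgf₀ hg₀ g₀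
  have hfar : ∀ x y : Fin (d + 1) → ℝ, ‖y - (f x).1‖ ≤ 1 / 8 →
      (∃ z : ℤ, (f x).2 = z) ∨ 1 / 4 ≤ centerDist y := fun x y hy => by
    rcases hf.mem x with ⟨i, z, hz⟩ | h
    · right
      refine le_trans ?_ (abs_le_centerDist y i)
      have hi := (norm_le_pi_norm _ i).trans hy
      rw [Pi.sub_apply, hz, Real.norm_eq_abs, abs_le] at hi
      have h0 := Int.floor_add_fract (y i)
      by_contra! hlt
      rw [abs_lt] at hlt
      have h1 : (⌊y i⌋ : ℝ) < z := by linarith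
      have h2 : (z : ℝ) < ⌊y i⌋ + 1 := by linarith
      norm_cast at h1 h2
      omega
    · exact .inl h
  have hfst : Continuous fun x => (f x).1 := continuous_fst.comp hf.continuous
  have hsnd : Continuous fun x => (f x).2 := continuous_snd.comp hf.continuous
  have hmem : ∀ L : ℝ, 8 ≤ L → ∀ x y : Fin (d + 1) → ℝ, ‖y - (f x).1‖ ≤ 1 / 8 →
      collapse L (y, (f x).2) ∈ gridSet (d + 1) := fun L hL x y hy => by
    rcases hfar x y hy with h | h
    · exact collapse_mem hL (.inr h)
    · rw [collapse_of_le (by simp only; nlinarith)]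
      exact zero_mem_gridSet
  have hvan : ∀ (L : ℝ) (x y : Fin (d + 1) → ℝ) i, x i ≤ 0 ∨ 1 ≤ x i →
      collapse L (y, (f x).2) = 0 := fun L x y i hx => by
    rw [hf.zero x i hx]
    exact collapse_zero_right L y
  have hloop : ∀ L : ℝ, 8 ≤ L → IsLoop fun x => collapse L (g x, (f x).2) := fun L hL =>
    ⟨(continuous_collapse L).comp (hg.continuous.prodMk hsnd), fun x => hmem L hL x _ (hgf x),
      fun x i hx => hvan L x _ i hx⟩
  have hcls : ∀ (L : ℝ) (hL : 8 ≤ L), hf.cls = (hloop L hL).cls := fun L hL => by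
    rw [← hf.cls_collapse hL]
    refine IsLoop.cls_eq _ _
      (fun s x => collapse L ((1 - s) • (f x).1 + s • g x, (f x).2))
      ((continuous_collapse L).comp ?_) (fun s hs x => hmem L hL x _ ?_)
      (fun s _ x i hx => hvan L x _ i hx) (fun x => by simp) (fun x => by simp)
    · have hgc := hg.continuous
      have hfc := hf.continuous
      fun_prop
    · have : (1 - s) • (f x).1 + s • g x - (f x).1 = s • (g x - (f x).1) := by module
      rw [this, norm_smul, Real.norm_of_nonneg hs.1]
      exact (mul_le_of_le_one_left (norm_nonneg _) hs.2).trans (hgf x)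
  set S : Set (Fin (d + 1) → ℝ) := {x | x ∈ Icc 0 1 ∧ centerDist (g x) = 0}
  have hS : IsCompact S := isCompact_Icc.inter_right
    (isClosed_eq (continuous_centerDist.comp hg.continuous) continuous_const)
  have hlocal : ∀ p ∈ S, ∃ (c : Fin (d + 1) → ℤ) (j : ℤ)
      (A : Matrix (Fin (d + 1)) (Fin (d + 1)) ℝ) (m : ℝ), A.det ≠ 0 ∧ 0 < m ∧
      (∀ v, m * ‖v‖ ≤ ‖A.mulVec v‖) ∧ ∀ᶠ x in 𝓝 p,
        ‖g x - center c - A.mulVec (x - p)‖ ≤ m / 2 * ‖x - p‖ ∧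
        ‖g x - center c‖ < 1 / 2 ∧ (f x).2 = j := by
    intro p hp
    have hc := centerDist_eq_zero hp.2
    obtain ⟨A, m, hA, hm, hAm, happ⟩ := exists_linear_approx (hg p) (hdet p _ hc)
    obtain ⟨j, hj⟩ := (hfar p (g p) (hgf p)).resolve_right (by rw [hp.2]; norm_num)
    refine ⟨fun i => ⌊g p i⌋, j, A, m, hA, hm, hAm, ?_⟩
    have e1 : ∀ᶠ x in 𝓝 p, ‖g x - center fun i => ⌊g p i⌋‖ < 1 / 2 := by
      refine ((hg.continuous.sub continuous_const).norm.continuousAt).eventually_lt_const ?_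
      simp only [← hc]
      norm_num
    have e2 : ∀ᶠ x in 𝓝 p, centerDist (g x) < 1 / 4 :=
      (continuous_centerDist.comp hg.continuous).continuousAt.eventually_lt_const
        (by simp [hp.2])
    have e3 : ∀ᶠ x in 𝓝 p, |(f x).2 - j| < 1 :=
      ((hsnd.sub continuous_const).abs.continuousAt).eventually_lt_const (by simp [hj])
    filter_upwards [happ, e1, e2, e3] with x h0 h1 h2 h3
    refine ⟨by simpa only [← hc] using h0, h1, ?_⟩
    obtain ⟨z, hz⟩ := (hfar x (g x) (hgf x)).resolve_right h2.not_ge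
    rw [hz] at h3 ⊢
    norm_cast at h3 ⊢
    rw [Int.abs_lt_one_iff] at h3
    omega
  choose! c j A m hA hm hAm hev using hlocal
  have hSfin : S.Finite := by
    refine hS.finite (isDiscrete_iff_nhdsNE.2 fun p hp => ?_)
    rw [← disjoint_iff, disjoint_principal_right]
    filter_upwards [nhdsWithin_le_nhds (hev p hp), self_mem_nhdsWithin] with x hx hxp hxS
    have h0 : g x - center (c p) = 0 := by
      have := centerDist_of_norm_lt hx.2.1
      rw [hxS.2] at this
      exact norm_eq_zero.1 this.symm
    have h1 := hx.1
    rw [h0, zero_sub, norm_neg] at h1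
    have h2 := norm_pos_iff.2 (sub_ne_zero.2 hxp)
    nlinarith [hAm p hp (x - p), hm p hp]
  have hr : ∀ᶠ r in 𝓝[>] (0 : ℝ), 0 < r ∧ ∀ p ∈ S,
      (∀ x, dist x p ≤ r → ‖g x - center (c p) - (A p).mulVec (x - p)‖ ≤ m p / 2 * ‖x - p‖ ∧
        ‖g x - center (c p)‖ < 1 / 2 ∧ (f x).2 = j p) ∧
      (j p ≠ 0 → ∀ i, r ≤ p i ∧ p i ≤ 1 - r) ∧
      ∀ q ∈ S, ∀ i, p i < q i → p i + 2 * r ≤ q i := by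
    refine (eventually_mem_nhdsWithin (a := (0 : ℝ)) (s := Ioi 0)).and ((eventually_all_finite hSfin).2 fun p hp => ?_)
    refine (eventually_forall_dist_le (hev p hp)).and (.and ?_ ?_)
    · by_cases hj : j p = 0
      · simp [hj]
      have hp2 : (f p).2 ≠ 0 := by
        rw [(hev p hp).self_of_nhds.2.2]
        exact_mod_cast hj
      simp only [hj, ne_eq, not_false_eq_true, forall_const]
      refine eventually_all.2 fun i => ?_
      have hi : 0 < p i ∧ p i < 1 := by
        by_contra! h
        refine hp2 ?_
        rw [hf.zero p i]
        · rfl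
        · by_contra! h'
          exact h'.2.not_ge (h h'.1)
      filter_upwards [nhdsWithin_le_nhds (eventually_lt_nhds hi.1),
        nhdsWithin_le_nhds (eventually_lt_nhds (sub_pos.2 hi.2))] with r h1 h2
      exact ⟨h1.le, by linarith⟩
    · refine (eventually_all_finite hSfin).2 fun q _ => eventually_all.2 fun i => ?_
      by_cases hpq : p i < q i
      · filter_upwards [nhdsWithin_le_nhds (eventually_lt_nhds (half_pos (sub_pos.2 hpq)))]
          with r h1 _
        linarith
      · simp [hpq]
  obtain ⟨r, hr0, hr⟩ := hr.exists
  obtain ⟨δ, hδ, hδS⟩ : ∃ δ > 0, ∀ x ∈ Icc (0 : Fin (d + 1) → ℝ) 1, (∀ p ∈ S, r ≤ dist x p) →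
      δ ≤ centerDist (g x) := by
    set K : Set (Fin (d + 1) → ℝ) := Icc 0 1 ∩ ⋂ p ∈ S, {x | r ≤ dist x p}
    have hK : IsCompact K := isCompact_Icc.inter_right (isClosed_biInter fun p _ =>
      isClosed_le continuous_const (continuous_id.dist continuous_const))
    rcases K.eq_empty_or_nonempty with hK' | hK'
    · refine ⟨1, one_pos, fun x hx hxS => ?_⟩
      have : x ∈ K := ⟨hx, mem_iInter₂.2 hxS⟩
      simp [hK'] at this
    · obtain ⟨x₀, hx₀, hmin⟩ := hK.exists_isMinOn hK'
        (continuous_centerDist.comp hg.continuous).continuousOn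
      refine ⟨centerDist (g x₀), (norm_nonneg _).lt_of_ne' fun h0 => ?_, fun x hx hxS =>
        isMinOn_iff.1 hmin x ⟨hx, mem_iInter₂.2 hxS⟩⟩
      have := mem_iInter₂.1 hx₀.2 x₀ ⟨hx₀.1, h0⟩
      rw [mem_ofPred_eq, dist_self] at this
      exact this.not_gt hr0
  obtain ⟨L, hL8, hLδ, hLm⟩ : ∃ L : ℝ, 8 ≤ L ∧ 2 ≤ L * δ ∧ ∀ p ∈ S, 2 ≤ L * (m p / 2 * r) := by
    have hlim {a : ℝ} (ha : 0 < a) : ∀ᶠ L in atTop, 2 ≤ L * a :=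
      (tendsto_id.atTop_mul_const ha).eventually_ge_atTop 2
    exact ((eventually_ge_atTop 8).and ((hlim hδ).and ((eventually_all_finite hSfin).2
      fun p hp => hlim (mul_pos (half_pos (hm p hp)) hr0)))).exists
  rw [hcls L hL8]
  refine (hloop L hL8).cls_mem_of_finset (hSfin.toFinset.filter fun p => j p ≠ 0) hr0
    (fun p hp => ?_) (fun p hp q hq => ?_) (fun x hx => ?_) fun p hp h hh h1 h2 => ?_
  · rw [Finset.mem_filter, Finite.mem_toFinset] at hp
    exact (hr p hp.1).2.1 hp.2
  · rw [Finset.mem_filter, Finite.mem_toFinset] at hp hq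
    exact (hr p hp.1).2.2 q hq.1
  · have hxI : x ∈ Icc (0 : Fin (d + 1) → ℝ) 1 := by
      by_contra hxI
      refine hx ?_
      have : ∃ i, x i ≤ 0 ∨ 1 ≤ x i := by
        by_contra! h
        exact hxI ⟨fun i => (h i).1.le, fun i => (h i).2.le⟩
      obtain ⟨i, hi⟩ := this
      exact hvan L x _ i hi
    obtain ⟨p, hp, hd⟩ : ∃ p ∈ S, dist x p < r := by
      by_contra! h
      refine hx (collapse_of_le (hLδ.trans ?_))
      exact mul_le_mul_of_nonneg_left (hδS x hxI h) (by linarith)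
    refine ⟨p, Finset.mem_filter.2 ⟨hSfin.mem_toFinset.2 hp, fun hj => hx ?_⟩, hd⟩
    rw [((hr p hp).1 x hd.le).2.2, hj, Int.cast_zero]
    exact collapse_zero_right L _
  · rw [Finset.mem_filter, Finite.mem_toFinset] at hp
    refine hh.cls_mem_of_approx (hH (c p) (j p) hp.2) hg.continuous hr0 ((hr p hp.1).2.1 hp.2)
      (L := L) (by linarith) (hm p hp.1) (hLm p hp.1) (A p) (hA p hp.1) (hAm p hp.1)
      (fun x hx => ((hr p hp.1).1 x hx).1) (fun x hx => ?_) h2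
    rw [h1 x hx, ((hr p hp.1).1 x hx.le).2.2]
    exact collapse_eq_cell hL8 hp.2 ((hr p hp.1).1 x hx.le).2.1

end Grid

namespace Grid

open Set Filter GenLoop CubicalCochain

variable {k d : ℕ}

/-- The height function whose zero set is a small sphere around the midpoint of a vertical edge. -/
noncomputable def level (c : Fin k → ℤ) (j : ℤ) (p : (Fin k → ℝ) × ℝ) : ℝ :=
  1 / 2 - 2 * ‖p.1 - center c‖ - |p.2 - j|

@[fun_prop]
theorem continuous_level (c : Fin k → ℤ) (j : ℤ) : Continuous (level c j) := by
  unfold level; fun_prop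

/-- A vector-valued map that vanishes nowhere on the grid and detects one cell. -/
noncomputable def detect (c : Fin k → ℤ) (j : ℤ) (p : (Fin k → ℝ) × ℝ) (i : ℕ) : ℝ :=
  if h : i < k then max 0 (level c j p + 1 / 2) * (p.1 - center c) ⟨i, h⟩ else level c j p

theorem detect_of_lt (c : Fin k → ℤ) (j : ℤ) (p : (Fin k → ℝ) × ℝ) (i : Fin k) :
    detect c j p i = max 0 (level c j p + 1 / 2) * (p.1 - center c) i := by
  simp [detect]

theorem detect_self (c : Fin k → ℤ) (j : ℤ) (p : (Fin k → ℝ) × ℝ) :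
    detect c j p k = level c j p := by
  simp [detect]

theorem continuous_detect (c : Fin k → ℤ) (j : ℤ) : Continuous (detect c j) := by
  refine continuous_pi fun i => ?_
  by_cases h : i < k
  · simp only [detect, h, dite_true]
    fun_prop
  · simp only [detect, h, dite_false]
    fun_prop

theorem abs_intCast_add_half (z : ℤ) : 1 / 2 ≤ |(z : ℝ) + 1 / 2| := by
  rw [le_abs]
  rcases le_or_gt 0 z with h | h
  · left
    have : (0 : ℝ) ≤ z := by exact_mod_cast h
    linarith
  · right
    have : (z : ℝ) ≤ -1 := by exact_mod_cast (by omega : z ≤ -1)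
    linarith

theorem exists_detect_ne_zero (c : Fin k → ℤ) (j : ℤ) {p : (Fin k → ℝ) × ℝ} (hp : p ∈ gridSet k) :
    ∃ i ≤ k, detect c j p i ≠ 0 := by
  by_contra! h
  have hL : level c j p = 0 := by rw [← detect_self, h k le_rfl]
  have hu : p.1 - center c = 0 := by
    ext i
    have := h i i.2.le
    rw [detect_of_lt, hL] at this
    norm_num at this
    simpa using this
  have ht : |p.2 - j| = 1 / 2 := by
    rw [level, hu, norm_zero] at hL
    linarith
  rcases hp with ⟨i, z, hz⟩ | ⟨z, hz⟩
  · have h1 := congrFun hu i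
    have h2 := abs_intCast_add_half (c i - z)
    simp only [Pi.sub_apply, hz, center, Pi.zero_apply] at h1
    rw [show ((c i - z : ℤ) : ℝ) + 1 / 2 = 0 by push_cast; linarith] at h2
    norm_num at h2
  · rw [hz] at ht
    have h3 : |((2 * (z - j) : ℤ) : ℝ)| = 1 := by
      push_cast
      rw [abs_mul, ht]
      norm_num
    rw [← Int.cast_abs] at h3
    have h4 : |2 * (z - j)| = 1 := by exact_mod_cast h3
    rw [abs_mul, abs_two] at h4
    omega

theorem level_le {c : Fin k → ℤ} {j : ℤ} {p : (Fin k → ℝ) × ℝ}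
    (h : 1 ≤ |p.2 - j| ∨ ∃ i, 1 / 2 ≤ |p.1 i - center c i|) : level c j p ≤ -(1 / 2) := by
  have h1 := norm_nonneg (p.1 - center c)
  have h2 := abs_nonneg (p.2 - j)
  rw [level]
  rcases h with h | ⟨i, hi⟩
  · linarith
  · have := (hi.trans_eq (Real.norm_eq_abs _).symm).trans (norm_le_pi_norm (p.1 - center c) i)
    linarith

theorem one_le_abs_sub {a b : ℤ} (h : a ≠ b) : (1 : ℝ) ≤ |(a : ℝ) - b| := by
  exact_mod_cast Int.one_le_abs (sub_ne_zero.2 h)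

theorem level_cell_le {c c' : Fin k → ℤ} {j j' : ℤ} (hj : j ≠ 0) {w : Fin k → ℝ}
    (h : 1 / 2 ≤ ‖w‖ ∨ c' ≠ c ∨ j' ≠ j) : level c j (cell c' j' w) ≤ -(1 / 2) := by
  refine level_le ?_
  rcases le_total 1 ‖w‖ with h1 | h1
  · left
    have := one_le_abs_sub hj.symm
    rw [cell, clip_of_one_le (r := 2 * ‖w‖ - 1) (by linarith)]
    simpa using this
  have hc : (cell c' j' w).1 = fun i => (c' i : ℝ) + 1 / 2 + half (w i) := by
    rw [cell, clip_of_nonpos (r := ‖w‖ - 1) (by linarith)]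
    simp
  rw [hc]
  rcases le_total (1 / 2) ‖w‖ with h2 | h2
  · right
    obtain ⟨i, hi⟩ := exists_half_of_le_norm h2
    refine ⟨i, ?_⟩
    rcases hi with hi | hi
    · have := abs_intCast_add_half (c' i - c i)
      simp only [hi, center]
      convert this using 2
      push_cast
      ring
    · have := abs_intCast_add_half (c' i - c i - 1)
      simp only [hi, center]
      convert this using 2
      push_cast
      ring
  have ht : (cell c' j' w).2 = j' := by
    rw [cell, clip_of_nonpos (r := 2 * ‖w‖ - 1) (by linarith)]
    simp
  rw [ht]
  by_cases hj' : j' = j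
  · by_cases hc' : c' = c
    · have h3 : 1 / 2 ≤ ‖w‖ := h.resolve_right (by simp [hc', hj'])
      right
      obtain ⟨i, hi⟩ := exists_half_of_le_norm h3
      refine ⟨i, ?_⟩
      rw [hc', center, add_sub_cancel_left]
      rcases hi with hi | hi <;> norm_num [hi]
    · right
      obtain ⟨i, hi⟩ := Function.ne_iff.1 hc'
      refine ⟨i, ?_⟩
      have h3 : |half (w i)| ≤ 1 / 2 := by
        rw [abs_le]
        exact ⟨le_max_left _ _, max_le (by norm_num) (min_le_left _ _)⟩
      have h4 := one_le_abs_sub hi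
      have h5 := abs_sub_abs_le_abs_sub ((c' i : ℝ) - c i) (-half (w i))
      rw [abs_neg] at h5
      rw [center]
      calc (1 : ℝ) / 2 ≤ |(c' i : ℝ) - c i - -half (w i)| := by linarith
        _ = _ := by congr 1; ring
  · left
    exact one_le_abs_sub hj'

theorem detect_cell_self {c : Fin k → ℤ} {j : ℤ} (hj : j ≠ 0) (w : Fin k → ℝ) (i : Fin k) :
    detect c j (cell c j w) i = max 0 (1 - 2 * ‖w‖) * w i := by
  rw [detect_of_lt]
  rcases le_total (1 / 2) ‖w‖ with h | h
  · rw [max_eq_left (by linarith [level_cell_le (c := c) (c' := c) (j' := j) hj (.inl h)]),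
      max_eq_left (by linarith), zero_mul, zero_mul]
  · have h1 : cell c j w = (center c + w, (j : ℝ)) := by
      rw [cell, clip_of_nonpos (by linarith), clip_of_nonpos (by linarith)]
      ext i
      · simp [center, half_of_abs_le ((norm_le_pi_norm w i).trans h)]
      · simp
    have h2 : level c j (cell c j w) = 1 / 2 - 2 * ‖w‖ := by
      simp [level, h1]
    rw [h2, h1]
    simp only [add_sub_cancel_left]
    congr 2
    ring

theorem level_cell_zero (c : Fin k → ℤ) (j : ℤ) : level c j (cell c j 0) = 1 / 2 := by
  have h1 : cell c j (0 : Fin k → ℝ) = (center c, (j : ℝ)) := by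
    rw [cell, norm_zero, clip_of_nonpos (by norm_num), clip_of_nonpos (by norm_num)]
    ext i <;> simp [center, half]
  simp [level, h1]

/-- The degree homomorphism attached to one cell. -/
noncomputable def cellDegree (c : Fin (d + 1) → ℤ) (j : ℤ) :
    HomotopyGroup (Fin (d + 1)) (gridSet (d + 1)) (origin (d + 1)) →*
      Multiplicative ((atTop : Filter ℕ).Germ ℤ) :=
  degreeHom (fun p => detect c j p.1) ((continuous_detect c j).comp continuous_subtype_val)
    fun p => exists_detect_ne_zero c j p.2

theorem IsLoop.extend_genLoop {f : (Fin k → ℝ) → (Fin k → ℝ) × ℝ} (hf : IsLoop f)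
    (x : Fin k → ℝ) : (extend hf.genLoop x).1 = f fun i => clamp x i := rfl

theorem coe_clamp_eq (x : Fin k → ℝ) : (fun i => (clamp x i : ℝ)) = proj x := by
  ext i
  rw [clamp, Set.coe_projIcc, proj, clip]

theorem proj_proj (x : Fin k → ℝ) : proj (proj x) = proj x := proj_of_mem (proj_mem x)

theorem cellDegree_generator_of_ne {c c' : Fin (d + 1) → ℤ} {j j' : ℤ} (hj : j ≠ 0)
    (h : c' ≠ c ∨ j' ≠ j) : cellDegree c j (isLoop_generator c' j').cls = 1 := by
  show Multiplicative.ofAdd (degree _ _) = Multiplicative.ofAdd 0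
  congr 1
  refine Germ.coe_eq.2 (.of_forall fun N => gridSum_eq_zero fun m =>
    degreeCochain_of_not_posOn fun hp => ?_)
  have := hp 0 (by simp)
  simp only [Function.comp_apply, detect_self, IsLoop.extend_genLoop] at this
  linarith [level_cell_le hj (.inr h) (w := (4 : ℝ) • (proj (fun i => ((clamp
    (fun i => ((m i : ℝ) + (0 : Fin (d + 1) → ℝ) i) / N) i : unitInterval) : ℝ)) -
      fun _ => (1 / 2 : ℝ)))]

theorem cellDegree_generator_self_ne {c : Fin (d + 1) → ℤ} {j : ℤ} (hj : j ≠ 0) :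
    ∃ e : ℕ → ℤ, (∀ᶠ N in atTop, e N ≠ 0) ∧
      cellDegree c j (isLoop_generator c j).cls =
        Multiplicative.ofAdd (e : (atTop : Filter ℕ).Germ ℤ) := by
  let W : (Fin (d + 1) → ℝ) → Fin (d + 1) → ℝ := fun x => (4 : ℝ) • (proj x - fun _ => (1 / 2 : ℝ))
  let G : (Fin (d + 1) → ℝ) → ℕ → ℝ := fun x =>
    detect c j (extend (isLoop_generator c j).genLoop x).1
  have hGc : Continuous G := (continuous_detect c j).comp
    (continuous_subtype_val.comp (continuous_extend _))
  have hG (x) : G x = detect c j (cell c j (W x)) := by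
    simp only [G, W, IsLoop.extend_genLoop, coe_clamp_eq, proj_proj]
  have hGi (x) (i : Fin (d + 1)) : G x i = max 0 (1 - 2 * ‖W x‖) * W x i := by
    rw [hG, detect_cell_self hj]
  have hGk (x) : G x (d + 1) = level c j (cell c j (W x)) := by
    rw [hG, detect_self]
  have hW {x : Fin (d + 1) → ℝ} (hx : x ∈ Icc (0 : Fin (d + 1) → ℝ) 1) (i : Fin (d + 1)) :
      W x i = 2 * (2 * x i - 1) := by
    simp only [W, proj_of_mem hx, Pi.smul_apply, Pi.sub_apply, smul_eq_mul]
    ring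
  let F : (Fin (d + 1 + 1) → ℝ) → ℕ → ℝ := fun z =>
    (1 - z 0) • standardFace (d + 1) (Fin.tail z) + z 0 • G (Fin.tail z)
  have htail : Continuous (Fin.tail : (Fin (d + 1 + 1) → ℝ) → Fin (d + 1) → ℝ) :=
    continuous_pi fun i => continuous_apply i.succ
  have hstd : Continuous (standardFace (d + 1)) := by
    refine continuous_pi fun i => ?_
    by_cases h : i < d + 1
    · simp only [standardFace, h, dite_true]
      fun_prop
    · simp only [standardFace, h, dite_false]
      fun_prop
  have hF : Continuous F := by
    have h0 : Continuous fun z : Fin (d + 1 + 1) → ℝ => z 0 := continuous_apply 0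
    exact ((continuous_const.sub h0).smul (hstd.comp htail)).add (h0.smul (hGc.comp htail))
  have hFi {z : Fin (d + 1 + 1) → ℝ} (hz : Fin.tail z ∈ Icc (0 : Fin (d + 1) → ℝ) 1)
      (i : Fin (d + 1)) : F z i =
        ((1 - z 0) + 2 * z 0 * max 0 (1 - 2 * ‖W (Fin.tail z)‖)) * (2 * Fin.tail z i - 1) := by
    simp only [F, Pi.add_apply, Pi.smul_apply, smul_eq_mul, hGi, hW hz]
    simp only [standardFace, i.2, dite_true, Fin.eta]
    ring
  have hFk (z) : F z (d + 1) = (1 - z 0) + z 0 * level c j (cell c j (W (Fin.tail z))) := by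
    simp only [F, Pi.add_apply, Pi.smul_apply, smul_eq_mul, hGk]
    simp [standardFace]
  have hmem {z : Fin (d + 1 + 1) → ℝ} (hz : z ∈ Icc (0 : Fin (d + 1 + 1) → ℝ) 1) :
      Fin.tail z ∈ Icc (0 : Fin (d + 1) → ℝ) 1 := ⟨fun i => hz.1 i.succ, fun i => hz.2 i.succ⟩
  have hne : ∀ z ∈ Icc (0 : Fin (d + 1 + 1) → ℝ) 1, ∃ i ≤ d + 1, F z i ≠ 0 := by
    intro z hz
    by_contra! h
    have hz0 : 0 ≤ z 0 := hz.1 0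
    have hz1 : z 0 ≤ 1 := hz.2 0
    have hm := le_max_left 0 (1 - 2 * ‖W (Fin.tail z)‖)
    have hk := h _ le_rfl
    rw [hFk] at hk
    by_cases hA : (1 - z 0) + 2 * z 0 * max 0 (1 - 2 * ‖W (Fin.tail z)‖) = 0
    · have h1 : z 0 = 1 := by nlinarith [mul_nonneg hz0 hm]
      rw [h1] at hA hk
      have h2 : 1 / 2 ≤ ‖W (Fin.tail z)‖ := by
        have := le_max_right 0 (1 - 2 * ‖W (Fin.tail z)‖)
        linarith
      linarith [level_cell_le (c := c) (c' := c) (j' := j) hj (.inl h2)]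
    · have h0 : W (Fin.tail z) = 0 := by
        ext i
        have := h i i.2.le
        rw [hFi (hmem hz)] at this
        rw [hW (hmem hz), (mul_eq_zero.1 this).resolve_left hA]
        simp
      rw [h0, level_cell_zero] at hk
      linarith
  refine ⟨fun N => gridSum N (degreeCochain (d + 1)) G, ?_, rfl⟩
  filter_upwards [eventually_faceSum_eq_zero hF hne, eventually_ne_atTop 0] with N hN hN0
  rw [faceSum, Fin.sum_univ_succ, Finset.sum_eq_zero, add_zero] at hN
  · have e0 : F ∘ face 0 0 = standardFace (d + 1) := by
      ext1 y
      simp [F, face, Fin.tail_def]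
    have e1 : F ∘ face 0 1 = G := by
      ext1 y
      simp [F, face, Fin.tail_def]
    rw [e0, e1] at hN
    simp only [Fin.val_zero, pow_zero, one_mul] at hN
    rw [sub_eq_zero.1 hN]
    exact gridSum_standardFace_ne_zero hN0
  · intro i _
    have key : ∀ ε : ℝ, ε = 0 ∨ ε = 1 →
        gridSum N (degreeCochain (d + 1)) (F ∘ face i.succ ε) = 0 := by
      intro ε hε
      have hε' : ε ∈ Icc (0 : ℝ) 1 := by rcases hε with rfl | rfl <;> simp
      refine gridSum_eq_zero fun m => ?_
      have hNpos : (0 : ℝ) < N := by positivity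
      set p : (Fin (d + 1) → ℝ) → Fin (d + 1 + 1) → ℝ :=
        fun x => face i.succ ε fun l => ((m l : ℝ) + x l) / N
      have hp0 (x) : p x 0 = ((m 0 : ℝ) + x 0) / N := by
        have := face_apply_succAbove i.succ ε (fun l => ((m l : ℝ) + x l) / N) 0
        rwa [Fin.succ_succAbove_zero] at this
      have hpi (x) : Fin.tail (p x) i = ε := face_apply_same _ _ _
      have hpm {x} (hx : x ∈ Icc (0 : Fin (d + 1) → ℝ) 1) : Fin.tail (p x) ∈ Icc 0 1 :=
        hmem (face_mem_Icc hε' (grid_mem_Icc m hx))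
      have hpW {x} (hx : x ∈ Icc (0 : Fin (d + 1) → ℝ) 1) : 2 ≤ ‖W (Fin.tail (p x))‖ := by
        refine le_trans ?_ (norm_le_pi_norm _ i)
        rw [hW (hpm hx), hpi]
        rcases hε with rfl | rfl <;> norm_num
      by_cases hm : (m 0 : ℕ) + 1 < N
      · refine degreeCochain_eq_zero (i := i) i.2 ?_
        have hlt {x} (hx : x ∈ Icc (0 : Fin (d + 1) → ℝ) 1) : p x 0 < 1 := by
          rw [hp0, div_lt_one hNpos]
          have h1 : x 0 ≤ 1 := hx.2 0
          have h2 : ((m 0 : ℕ) : ℝ) + 1 < N := by exact_mod_cast hm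
          linarith
        have hv {x} (hx : x ∈ Icc (0 : Fin (d + 1) → ℝ) 1) :
            F (p x) i = (1 - p x 0) * (2 * ε - 1) := by
          rw [hFi (hpm hx), hpi, max_eq_left (by linarith [hpW hx])]
          ring
        rcases hε with rfl | rfl
        · right
          intro x hx
          have := hlt hx
          show F (p x) i < 0
          rw [hv hx]
          linarith
        · left
          intro x hx
          have := hlt hx
          show 0 < F (p x) i
          rw [hv hx]
          linarith
      · refine degreeCochain_of_not_posOn fun hpos => ?_
        have h1 : (1 : Fin (d + 1) → ℝ) ∈ Icc (0 : Fin (d + 1) → ℝ) 1 := by simp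
        have h2 : p 1 0 = 1 := by
          rw [hp0, div_eq_one_iff_eq hNpos.ne']
          have := (m 0).2
          have : (m 0 : ℕ) + 1 = N := by omega
          simp only [Pi.one_apply]
          exact_mod_cast this
        have h3 : 0 < F (p 1) (d + 1) := hpos 1 h1
        rw [hFk, h2] at h3
        have h4 : 1 / 2 ≤ ‖W (Fin.tail (p 1))‖ := by linarith [hpW h1]
        linarith [level_cell_le (c := c) (c' := c) (j' := j) hj (.inl h4)]
    rw [key 0 (.inl rfl), key 1 (.inr rfl)]
    simp

end Grid

namespace GenLoop

open scoped unitInterval Topology Topology.Homotopy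

variable {N X Y : Type*} [TopologicalSpace X] [TopologicalSpace Y] {x : X} {y : Y}

/-- The image of a generalized loop under a continuous map. -/
def map (φ : C(X, Y)) (h : φ x = y) (f : Ω^ N X x) : Ω^ N Y y :=
  ⟨φ.comp f.1, fun t ht => (congrArg φ (f.2 t ht)).trans h⟩

variable [DecidableEq N] [Nonempty N]

/-- The homomorphism of homotopy groups induced by a continuous map. -/
noncomputable def homotopyGroupMap (φ : C(X, Y)) (h : φ x = y) : HomotopyGroup N X x →* HomotopyGroup N Y y :=
  MonoidHom.mk' (Quotient.map (map φ h) fun _ _ ⟨F⟩ => ⟨F.compContinuousMap φ⟩) <| by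
    rintro ⟨f⟩ ⟨g⟩
    let i := Classical.arbitrary N
    refine (congrArg _ (HomotopyGroup.mul_spec (i := i) (p := f) (q := g))).trans
      (Eq.trans ?_ (HomotopyGroup.mul_spec (i := i) (p := map φ h f) (q := map φ h g)).symm)
    exact congrArg (fun f => (⟦f⟧ : HomotopyGroup N Y y))
      (GenLoop.ext _ _ fun t => apply_ite φ _ _ _)

end GenLoop

theorem IsCoveringMap.exists_homotopyRel_lift {A E X : Type*} [TopologicalSpace A]
    [TopologicalSpace E] [TopologicalSpace X] [PreconnectedSpace A] {p : E → X}
    (cov : IsCoveringMap p) {f₀ f₁ : C(A, X)} {f₀' f₁' : C(A, E)} {S : Set A}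
    (F : f₀.HomotopyRel f₁ S) (he : ∃ a ∈ S, f₀' a = f₁' a) (h₀ : p ∘ f₀' = f₀)
    (h₁ : p ∘ f₁' = f₁) : ∃ K : f₀'.HomotopyRel f₁' S, ∀ z, p (K z) = F z :=
  ⟨cov.liftHomotopyRel F he h₀ h₁, congrFun (cov.liftHomotopy_lifts F.toContinuousMap f₀'
    fun a => (F.apply_zero a).trans (congrFun h₀ a).symm)⟩

namespace Grid

open Set GenLoop
open scoped unitInterval

variable {d : ℕ}

theorem coe_eq_zero_iff_exists_intCast {r : ℝ} : (r : AddCircle (1 : ℝ)) = 0 ↔ ∃ z : ℤ, r = z := by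
  rw [AddCircle.coe_eq_zero_iff]
  simp [eq_comm]

/-- A real function that is integral where some coordinate lies outside the open unit interval,
and that vanishes at the origin, vanishes wherever some coordinate lies outside that interval. -/
theorem eq_zero_of_coe_eq_zero {F : (Fin (d + 2) → ℝ) → ℝ} (hF : Continuous F) (h0 : F 0 = 0)
    (h : ∀ y i, y i ≤ 0 ∨ 1 ≤ y i → (F y : AddCircle (1 : ℝ)) = 0) {y : Fin (d + 2) → ℝ}
    {i : Fin (d + 2)} (hy : y i ≤ 0 ∨ 1 ≤ y i) : F y = 0 := by
  have path {g : I → Fin (d + 2) → ℝ} (hg : Continuous g)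
      (hg' : ∀ t, ∃ i, g t i ≤ 0 ∨ 1 ≤ g t i) : F (g 1) = F (g 0) := by
    have h' (t) : (F (g t) : AddCircle (1 : ℝ)) = 0 := (hg' t).elim fun i hi => h _ i hi
    exact (AddCircle.isCoveringMap_coe (1 : ℝ)).const_of_comp (hF.comp hg)
      (fun t t' => (h' t).trans (h' t').symm) 1 0
  have nonpos {y : Fin (d + 2) → ℝ} {i : Fin (d + 2)} (hy : y i ≤ 0) : F y = 0 := by
    have := path (g := fun t => (t : ℝ) • y) (by fun_prop)
      fun t => ⟨i, .inl (mul_nonpos_of_nonneg_of_nonpos t.2.1 hy)⟩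
    simpa [h0] using this
  rcases hy with hy | hy
  · exact nonpos hy
  · obtain ⟨m, hm⟩ := exists_ne i
    have := path (g := fun t => Function.update y m ((t : ℝ) * y m)) (by fun_prop)
      fun t => ⟨i, .inr (by rwa [Function.update_of_ne hm.symm])⟩
    simp only [Set.Icc.coe_one, one_mul, Function.update_eq_self, Set.Icc.coe_zero, zero_mul] at this
    rw [this]
    exact nonpos (i := m) (by simp)

/-- The coordinates of a point, with the height coming first. -/
def coordinates (p : (Fin d → ℝ) × ℝ) : Fin (d + 1) → ℝ := Fin.cons p.2 p.1

theorem continuous_coordinates : Continuous (coordinates (d := d)) := by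
  refine continuous_pi fun i => ?_
  refine Fin.cases ?_ (fun i => ?_) i
  · exact continuous_snd
  · exact (continuous_apply i).comp continuous_fst

theorem mem_gridSet_iff {p : (Fin d → ℝ) × ℝ} :
    p ∈ gridSet d ↔ ∃ i, (coordinates p i : AddCircle (1 : ℝ)) = 0 := by
  simp only [Fin.exists_fin_succ, coe_eq_zero_iff_exists_intCast, coordinates, Fin.cons_zero,
    Fin.cons_succ, gridSet, Set.mem_ofPred_eq]
  exact or_comm

/-- The covering of the skeleton of the torus by the grid. -/
def cover : C(gridSet d, {y : Fin (d + 1) → AddCircle (1 : ℝ) // ∃ j, y j = 0}) where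
  toFun p := ⟨fun i => (coordinates p.1 i : AddCircle (1 : ℝ)), mem_gridSet_iff.1 p.2⟩
  continuous_toFun := Continuous.subtype_mk (continuous_pi fun i =>
    (AddCircle.continuous_mk' 1).comp ((continuous_apply i).comp
      (continuous_coordinates.comp continuous_subtype_val))) _

theorem coordinates_zero : coordinates (0 : (Fin d → ℝ) × ℝ) = 0 := by
  ext i
  refine Fin.cases rfl (fun i => rfl) i

theorem cover_origin : cover (origin d) = ⟨0, 0, rfl⟩ := by
  refine Subtype.ext (funext fun i => ?_)
  show ((coordinates (0 : (Fin d → ℝ) × ℝ) i : ℝ) : AddCircle (1 : ℝ)) = 0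
  rw [coordinates_zero]
  rfl

theorem coordinates_mk (v : Fin (d + 1) → ℝ) : coordinates (fun i => v i.succ, v 0) = v :=
  Fin.cons_self_tail v

theorem homotopyGroupMap_cover_injective :
    Function.Injective (homotopyGroupMap (N := Fin (d + 2)) (cover (d := d + 2)) cover_origin) := by
  rintro ⟨f⟩ ⟨g⟩ hfg
  obtain ⟨F⟩ : Homotopic (GenLoop.map cover cover_origin f) (GenLoop.map cover cover_origin g) :=
    Quotient.exact hfg
  let c (i : Fin (d + 3)) : C(gridSet (d + 2), ℝ) :=
    ⟨fun p => coordinates p.1 i, (continuous_apply i).comp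
      (continuous_coordinates.comp continuous_subtype_val)⟩
  let e (i : Fin (d + 3)) : C({y : Fin (d + 3) → AddCircle (1 : ℝ) // ∃ j, y j = 0},
      AddCircle (1 : ℝ)) := ⟨fun y => y.1 i, (continuous_apply i).comp continuous_subtype_val⟩
  have cov := AddCircle.isCoveringMap_coe (1 : ℝ)
  have hb : (0 : Fin (d + 2) → I) ∈ Cube.boundary (Fin (d + 2)) := ⟨0, .inl rfl⟩
  have lift (i : Fin (d + 3)) : ∃ K : ((c i).comp f.1).HomotopyRel ((c i).comp g.1)
      (Cube.boundary (Fin (d + 2))), ∀ z, ((K z : ℝ) : AddCircle (1 : ℝ)) = (F z).1 i :=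
    cov.exists_homotopyRel_lift (F.compContinuousMap (e i))
      ⟨0, hb, congrArg (c i) ((f.2 0 hb).trans (g.2 0 hb).symm)⟩ rfl rfl
  choose K hK using lift
  refine Quotient.sound (homotopic_of_continuous
    (fun s y => ⟨(fun i => K i.succ (s, y), K 0 (s, y)), mem_gridSet_iff.2 ?_⟩) ?_ ?_ ?_ ?_)
  · obtain ⟨j, hj⟩ := (F (s, y)).2
    refine ⟨j, ?_⟩
    rw [coordinates_mk fun i => K i (s, y), hK, hj]
  · exact Continuous.subtype_mk (.prodMk (continuous_pi fun i : Fin (d + 2) => (K i.succ).continuous)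
      (K 0).continuous) _
  · intro y
    refine Subtype.ext (Prod.ext (funext fun i => ?_) ?_)
    exacts [(K i.succ).apply_zero y, (K 0).apply_zero y]
  · intro y
    refine Subtype.ext (Prod.ext (funext fun i => ?_) ?_)
    exacts [(K i.succ).apply_one y, (K 0).apply_one y]
  · intro s y hy
    have key (i) : K i (s, y) = c i (origin (d + 2)) :=
      ((K i).eq_fst s hy).trans (congrArg (c i) (f.2 y hy))
    exact Subtype.ext (Prod.ext (funext fun i => key i.succ) (key 0))

theorem homotopyGroupMap_cover_surjective :
    Function.Surjective (homotopyGroupMap (N := Fin (d + 2)) (cover (d := d + 2)) cover_origin) := by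
  rintro ⟨f⟩
  have cov := AddCircle.isCoveringMap_coe (1 : ℝ)
  have hf0 : extend f 0 = ⟨0, 0, rfl⟩ := extend_eq f 0 (.inl le_rfl)
  have lift (i : Fin (d + 3)) : ∃ F : C(Fin (d + 2) → ℝ, ℝ), F 0 = 0 ∧
      ∀ y, ((F y : ℝ) : AddCircle (1 : ℝ)) = (extend f y).1 i := by
    obtain ⟨F, ⟨h, h'⟩, -⟩ := cov.existsUnique_continuousMap_lifts
      (⟨fun y => (extend f y).1 i, (continuous_apply i).comp
        (continuous_subtype_val.comp (continuous_extend f))⟩ :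
        C(Fin (d + 2) → ℝ, AddCircle (1 : ℝ))) 0 0 (by
          show ((0 : ℝ) : AddCircle (1 : ℝ)) = (extend f 0).1 i
          rw [hf0]
          rfl)
    exact ⟨F, h, congrFun h'⟩
  choose F hF0 hF using lift
  have hv (i : Fin (d + 3)) {y : Fin (d + 2) → ℝ} {l} (hy : y l ≤ 0 ∨ 1 ≤ y l) : F i y = 0 :=
    eq_zero_of_coe_eq_zero (F i).continuous (hF0 i)
      (fun y l hy => by rw [hF, extend_eq f l hy]; rfl) hy
  have hL : IsLoop fun y => (fun i : Fin (d + 2) => F i.succ y, F 0 y) := by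
    refine ⟨by fun_prop, fun y => mem_gridSet_iff.2 ?_, fun y l hy => ?_⟩
    · obtain ⟨j, hj⟩ := (extend f y).2
      exact ⟨j, by rw [coordinates_mk fun i => F i y, hF, hj]⟩
    · exact Prod.ext (funext fun i => hv i.succ hy) (hv 0 hy)
  refine ⟨hL.cls, congrArg _ (GenLoop.ext _ _ fun y => Subtype.ext (funext fun i => ?_))⟩
  show ((coordinates (_, _) i : ℝ) : AddCircle (1 : ℝ)) = (f y).1 i
  rw [coordinates_mk fun i => F i fun l => y l, hF, extend_coe]

end Grid

namespace Grid

open Set Filter GenLoop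

variable {d : ℕ}

/-- The indices of the cells of the grid that carry the free generators. -/
abbrev CellIndex (k : ℕ) : Type := {b : (Fin k → ℤ) × ℤ // b.2 ≠ 0}

/-- The homomorphism from the free abelian group on the cells to the homotopy group of the grid. -/
noncomputable def generatorHom (d : ℕ) : FreeAbelianGroup (CellIndex (d + 2)) →+
    Additive (HomotopyGroup (Fin (d + 2)) (gridSet (d + 2)) (origin (d + 2))) :=
  FreeAbelianGroup.lift fun b => Additive.ofMul (isLoop_generator b.1.1 b.1.2).cls

theorem generatorHom_injective : Function.Injective (generatorHom d) := by
  refine (injective_iff_map_eq_zero _).2 fun a ha => ?_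
  refine (FreeAbelianGroup.equivFinsupp _).injective (Finsupp.ext fun b => ?_)
  obtain ⟨e, he, hb⟩ := cellDegree_generator_self_ne (c := b.1.1) (j := b.1.2) b.2
  have key : (MonoidHom.toAdditiveLeft (cellDegree b.1.1 b.1.2)).comp (generatorHom d) =
      (zmultiplesHom _ (e : (atTop : Filter ℕ).Germ ℤ)).comp (FreeAbelianGroup.coeff b) := by
    refine FreeAbelianGroup.lift_ext _ _ fun b' => ?_
    rw [AddMonoidHom.comp_apply, AddMonoidHom.comp_apply, generatorHom,
      FreeAbelianGroup.lift_apply_of]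
    rcases eq_or_ne b' b with rfl | h
    · refine (congrArg Multiplicative.toAdd hb).trans ?_
      simp [FreeAbelianGroup.coeff]
    · have h' : b'.1.1 ≠ b.1.1 ∨ b'.1.2 ≠ b.1.2 := by
        by_contra! h''
        exact h (Subtype.ext (Prod.ext h''.1 h''.2))
      refine (congrArg Multiplicative.toAdd (cellDegree_generator_of_ne b.2 h')).trans ?_
      simp [FreeAbelianGroup.coeff, h]
  have h0 := DFunLike.congr_fun key a
  rw [AddMonoidHom.comp_apply, ha, map_zero, AddMonoidHom.comp_apply, zmultiplesHom_apply] at h0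
  have h1 : ∀ᶠ N in atTop, 0 = FreeAbelianGroup.coeff b a • e N := Germ.coe_eq.1 h0
  obtain ⟨N, hN, hN'⟩ := (h1.and he).exists
  rw [map_zero]
  exact (smul_eq_zero.1 hN.symm).resolve_right hN'

theorem generatorHom_surjective : Function.Surjective (generatorHom d) := by
  intro a
  let H : Subgroup (HomotopyGroup (Fin (d + 2)) (gridSet (d + 2)) (origin (d + 2))) :=
    AddSubgroup.toSubgroup' (generatorHom d).range
  have hH : ∀ c j, j ≠ 0 → (isLoop_generator c j).cls ∈ H := fun c j hj =>
    ⟨FreeAbelianGroup.of ⟨(c, j), hj⟩, FreeAbelianGroup.lift_apply_of _ _⟩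
  obtain ⟨f, hf⟩ := Quotient.exists_rep a.toMul
  have := cls_mem_of_generators hH (isLoop_extend f)
  rw [cls_extend, hf] at this
  exact this

theorem nonempty_mulEquiv_freeAbelianGroup :
    Nonempty (HomotopyGroup (Fin (d + 2))
      {y : Fin (d + 3) → AddCircle (1 : ℝ) // ∃ j, y j = 0} ⟨0, 0, rfl⟩ ≃*
        Multiplicative (FreeAbelianGroup (Fin (d + 3) → ℤ))) := by
  let e₁ := MulEquiv.ofBijective (homotopyGroupMap (N := Fin (d + 2)) (cover (d := d + 2))
    cover_origin) ⟨homotopyGroupMap_cover_injective, homotopyGroupMap_cover_surjective⟩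
  let e₂ := AddEquiv.ofBijective (generatorHom d) ⟨generatorHom_injective, generatorHom_surjective⟩
  have : Infinite (CellIndex (d + 2)) :=
    Infinite.of_injective (fun m : ℕ => ⟨(0, (m : ℤ) + 1), by positivity⟩) fun m m' h => by
      simpa using h
  obtain ⟨e₃⟩ := nonempty_equiv_of_countable (α := CellIndex (d + 2)) (β := Fin (d + 3) → ℤ)
  exact ⟨e₁.symm.trans (AddEquiv.toMultiplicativeRight
    (e₂.symm.trans (FreeAbelianGroup.equivOfEquiv e₃)))⟩

end Grid

/-- For `n ≥ 3`, the homotopy group `π_{n−1}(N₀, 0)` of the `(n−1)`-skeleton `N₀` of the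
torus `(ℝ/ℤ)ⁿ` is isomorphic, as a group, to the free abelian group on the set `ℤⁿ`
(the direct sum of copies of `ℤ` indexed by `ℤⁿ`). Here `n − 1` is written as
`n − 2 + 1`, which is equal to it since `n ≥ 3`. -/
theorem stmt_16 (n : ℕ) (hn : 3 ≤ n) :
    Nonempty ((HomotopyGroup.Pi (n - 2 + 1)
        {y : Fin n → AddCircle (1 : ℝ) // ∃ j, y j = 0}
        ⟨0, ⟨⟨0, by omega⟩, rfl⟩⟩)
      ≃* Multiplicative (FreeAbelianGroup (Fin n → ℤ))) := by
  obtain ⟨d, rfl⟩ : ∃ d, n = d + 3 := ⟨n - 3, by omega⟩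
  exact Grid.nonempty_mulEquiv_freeAbelianGroup
end
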